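/- arXiv:2602.03899 — 10 statements merged into one kernel-verified Lean document; each statement's English description precedes it below -/
import Mathlib

section
/- Let d ≥ 1 and let n, f be integers with f ≥ 1 and n > 2f. For every function F : (ℝ^d)^n → ℝ^d and every δ > 0, there exist vectors x_1,…,x_n ∈ ℝ^d and a set S ⊆ {1,…,n} with |S| = n−f and Σ_S > 0 such that ‖F(x_1,…,x_n) − x̄_S‖² ≥ (f/(n−2f) − δ) · Σ_S. (Universal lower bound: the robustness coefficient κ* of any aggregation rule satisfies κ* ≥ f/(n−2f).) -/
open Finset

/-- Mean of the vectors indexed by a finite set `A`. -/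
noncomputable def meanVec {d n : ℕ} (x : Fin n → EuclideanSpace ℝ (Fin d))
    (A : Finset (Fin n)) : EuclideanSpace ℝ (Fin d) :=
  (A.card : ℝ)⁻¹ • ∑ i ∈ A, x i

/-- Empirical variance of the vectors indexed by a finite set `A`. -/
noncomputable def varVec {d n : ℕ} (x : Fin n → EuclideanSpace ℝ (Fin d))
    (A : Finset (Fin n)) : ℝ :=
  (A.card : ℝ)⁻¹ * ∑ i ∈ A, ‖x i - meanVec x A‖ ^ 2

/-- `N` is a neighbor selection: `N y` consists of `n - f` indices of points
closest to `y` among `x 1, …, x n`. -/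
def IsNbhdSel {d n : ℕ} (f : ℕ) (x : Fin n → EuclideanSpace ℝ (Fin d))
    (N : EuclideanSpace ℝ (Fin d) → Finset (Fin n)) : Prop :=
  ∀ y, (N y).card = n - f ∧ ∀ i ∈ N y, ∀ j ∉ N y, ‖y - x i‖ ≤ ‖y - x j‖

/-- The score associated to a neighbor selection `N`. -/
noncomputable def score {d n : ℕ} (f : ℕ) (x : Fin n → EuclideanSpace ℝ (Fin d))
    (N : EuclideanSpace ℝ (Fin d) → Finset (Fin n))
    (y : EuclideanSpace ℝ (Fin d)) : ℝ :=
  ((n : ℝ) - (f : ℝ))⁻¹ * ∑ i ∈ N y, ‖y - x i‖ ^ 2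

/-- `Sm` is an `m`-MultiKrum selection with respect to the score `s`:
it consists of `m` indices whose points have the smallest scores. -/
def IsMultiKrumSel {d n : ℕ} (m : ℕ) (x : Fin n → EuclideanSpace ℝ (Fin d))
    (s : EuclideanSpace ℝ (Fin d) → ℝ) (Sm : Finset (Fin n)) : Prop :=
  Sm.card = m ∧ ∀ i ∈ Sm, ∀ j ∉ Sm, s (x i) ≤ s (x j)

theorem ulb_card_lt (n k : ℕ) (hk : k ≤ n) :
    (univ.filter (fun i : Fin n => i.val < k)).card = k := by
  rw [Fin.card_filter_val_lt]; omega

theorem ulb_card_ge (n k : ℕ) (hk : k ≤ n) :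
    (univ.filter (fun i : Fin n => k ≤ i.val)).card = n - k := by
  have h := Finset.card_filter_add_card_filter_not (s := (univ : Finset (Fin n)))
    (fun i : Fin n => i.val < k)
  rw [ulb_card_lt n k hk] at h
  simp only [not_lt, Finset.card_univ, Fintype.card_fin] at h
  omega

/-- The adversarial configuration. -/
noncomputable def ulbX {d : ℕ} (n f : ℕ) (e : EuclideanSpace ℝ (Fin d)) (ε : ℝ) :
    Fin n → EuclideanSpace ℝ (Fin d) :=
  fun i => if i.val < f then e else if i.val = n - 1 then ε • e else 0

theorem ulb_mean1 {d : ℕ} (n f : ℕ) (hf : 1 ≤ f) (hn : 2 * f < n)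
    (e : EuclideanSpace ℝ (Fin d)) (ε : ℝ) :
    meanVec (ulbX n f e ε) (univ.filter (fun i : Fin n => i.val < n - f)) =
      ((f : ℝ) / ((n : ℝ) - f)) • e := by
  unfold meanVec
  rw [ulb_card_lt n (n - f) (by omega), Nat.cast_sub (by omega)]
  have h : ∑ i ∈ univ.filter (fun i : Fin n => i.val < n - f), ulbX n f e ε i
      = ∑ i ∈ univ.filter (fun i : Fin n => i.val < f), e := by
    rw [Finset.sum_filter, Finset.sum_filter]
    apply Finset.sum_congr rfl
    intro i _
    unfold ulbX
    split_ifs <;> first | rfl | omega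
  rw [h, Finset.sum_const, ulb_card_lt n f (by omega), ← Nat.cast_smul_eq_nsmul ℝ, smul_smul]
  congr 1
  ring

theorem ulb_var1 {d : ℕ} (n f : ℕ) (hf : 1 ≤ f) (hn : 2 * f < n)
    (e : EuclideanSpace ℝ (Fin d)) (he : ‖e‖ = 1) (ε : ℝ) :
    varVec (ulbX n f e ε) (univ.filter (fun i : Fin n => i.val < n - f)) =
      (f : ℝ) * (n - 2 * f) / ((n : ℝ) - f) ^ 2 := by
  unfold varVec
  rw [ulb_mean1 n f hf hn, ulb_card_lt n (n - f) (by omega), Nat.cast_sub (by omega)]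
  set m : ℝ := (f : ℝ) / ((n : ℝ) - f) with hm
  have h : ∑ i ∈ univ.filter (fun i : Fin n => i.val < n - f), ‖ulbX n f e ε i - m • e‖ ^ 2
      = ∑ i ∈ univ.filter (fun i : Fin n => i.val < n - f), m ^ 2
        + ∑ i ∈ univ.filter (fun i : Fin n => i.val < f), ((1 - m) ^ 2 - m ^ 2) := by
    rw [Finset.sum_filter, Finset.sum_filter, Finset.sum_filter, ← Finset.sum_add_distrib]
    apply Finset.sum_congr rfl
    intro i _
    have h1 : ‖e - m • e‖ ^ 2 = (1 - m) ^ 2 := by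
      have : e - m • e = (1 - m) • e := by rw [sub_smul, one_smul]
      rw [this, norm_smul, he, mul_one, Real.norm_eq_abs, sq_abs]
    have h2 : ‖0 - m • e‖ ^ 2 = m ^ 2 := by
      rw [zero_sub, norm_neg, norm_smul, he, mul_one, Real.norm_eq_abs, sq_abs]
    unfold ulbX
    split_ifs <;> first | omega | (rw [h1]; ring) | (rw [h2]; ring) | simp
  rw [h, Finset.sum_const, Finset.sum_const, ulb_card_lt n f (by omega),
    ulb_card_lt n (n - f) (by omega), nsmul_eq_mul, nsmul_eq_mul, Nat.cast_sub (by omega)]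
  have : (2 : ℝ) * f < n := by exact_mod_cast hn
  have h0 : (0 : ℝ) ≤ f := by positivity
  have hne : (n : ℝ) - f ≠ 0 := by linarith
  rw [hm]
  field_simp
  ring

theorem ulb_var0_pos {d : ℕ} (n f : ℕ) (hf : 1 ≤ f) (hn : 2 * f < n)
    (e : EuclideanSpace ℝ (Fin d)) (he : ‖e‖ = 1) (ε : ℝ) (hε : 0 < ε) :
    0 < varVec (ulbX n f e ε) (univ.filter (fun i : Fin n => f ≤ i.val)) := by
  unfold varVec
  rw [ulb_card_ge n f (by omega)]
  have hc : (0 : ℝ) < ((n - f : ℕ) : ℝ) := by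
    exact_mod_cast (by omega : 0 < n - f)
  refine mul_pos (inv_pos.mpr hc) ?_
  set μ := meanVec (ulbX n f e ε) (univ.filter (fun i : Fin n => f ≤ i.val))
  by_contra hcon
  have hz := le_antisymm (not_lt.mp hcon) (Finset.sum_nonneg (fun i _ => by positivity))
  rw [Finset.sum_eq_zero_iff_of_nonneg (fun i _ => by positivity)] at hz
  have ha := hz ⟨f, by omega⟩ (by simp)
  have hb := hz ⟨n - 1, by omega⟩ (by simp; omega)
  have hne : f ≠ n - 1 := by omega
  have hlt : ¬ (n - 1 < f) := by omega
  simp only [ulbX, lt_irrefl, if_false, hne, hlt, if_true, pow_eq_zero_iff, ne_eq,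
    OfNat.ofNat_ne_zero, not_false_eq_true, norm_eq_zero, sub_eq_zero] at ha hb
  rw [← ha] at hb
  have := congrArg norm hb
  rw [norm_smul, he, norm_zero, mul_one, Real.norm_eq_abs, abs_of_pos hε] at this
  linarith

theorem ulb_cont {d : ℕ} (n f : ℕ) (e : EuclideanSpace ℝ (Fin d)) (i : Fin n) :
    Continuous (fun ε : ℝ => ulbX n f e ε i) := by
  unfold ulbX
  split_ifs <;> fun_prop

theorem ulb_cont_mean {d : ℕ} (n f : ℕ) (e : EuclideanSpace ℝ (Fin d)) (A : Finset (Fin n)) :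
    Continuous (fun ε : ℝ => meanVec (ulbX n f e ε) A) := by
  unfold meanVec
  have h : Continuous (fun ε : ℝ => ∑ i ∈ A, ulbX n f e ε i) :=
    continuous_finsetSum _ (fun i _ => ulb_cont n f e i)
  exact h.const_smul ((A.card : ℝ)⁻¹)

theorem ulb_cont_var {d : ℕ} (n f : ℕ) (e : EuclideanSpace ℝ (Fin d)) (A : Finset (Fin n)) :
    Continuous (fun ε : ℝ => varVec (ulbX n f e ε) A) := by
  unfold varVec
  exact continuous_const.mul (continuous_finsetSum _ (fun i _ =>
    (((ulb_cont n f e i).sub (ulb_cont_mean n f e A)).norm.pow 2)))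

theorem ulb_mean0 {d : ℕ} (n f : ℕ) (e : EuclideanSpace ℝ (Fin d)) :
    meanVec (ulbX n f e 0) (univ.filter (fun i : Fin n => f ≤ i.val)) = 0 := by
  unfold meanVec
  rw [Finset.sum_eq_zero, smul_zero]
  intro i hi
  have : ¬ (i.val < f) := by simpa using hi
  simp [ulbX, this]

theorem ulb_var0 {d : ℕ} (n f : ℕ) (e : EuclideanSpace ℝ (Fin d)) :
    varVec (ulbX n f e 0) (univ.filter (fun i : Fin n => f ≤ i.val)) = 0 := by
  unfold varVec
  rw [ulb_mean0, Finset.sum_eq_zero, mul_zero]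
  intro i hi
  have : ¬ (i.val < f) := by simpa using hi
  simp [ulbX, this]

/-- Universal lower bound: for any aggregation rule `F`, its robustness coefficient
is at least `f / (n - 2f)`. -/
theorem universal_lower_bound {d : ℕ} (hd : 1 ≤ d) (n f : ℕ) (hf : 1 ≤ f)
    (hn : 2 * f < n)
    (F : (Fin n → EuclideanSpace ℝ (Fin d)) → EuclideanSpace ℝ (Fin d))
    (δ : ℝ) (hδ : 0 < δ) :
    ∃ (x : Fin n → EuclideanSpace ℝ (Fin d)) (S : Finset (Fin n)),
      S.card = n - f ∧ 0 < varVec x S ∧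
      ‖F x - meanVec x S‖ ^ 2 ≥
        ((f : ℝ) / ((n : ℝ) - 2 * (f : ℝ)) - δ) * varVec x S := by
  by_contra hcon
  push Not at hcon
  set e : EuclideanSpace ℝ (Fin d) := EuclideanSpace.single ⟨0, by omega⟩ 1 with hedef
  have he : ‖e‖ = 1 := by simp [hedef]
  set S0 := univ.filter (fun i : Fin n => f ≤ i.val) with hS0
  set S1 := univ.filter (fun i : Fin n => i.val < n - f) with hS1
  set K : ℝ := (f : ℝ) / ((n : ℝ) - 2 * (f : ℝ)) - δ with hK
  have hn' : (2 : ℝ) * f < n := by exact_mod_cast hn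
  have hf' : (1 : ℝ) ≤ f := by exact_mod_cast hf
  set V : ℝ := (f : ℝ) * (n - 2 * f) / ((n : ℝ) - f) ^ 2 with hV
  have hVpos : 0 < V := by
    have h1 : (0 : ℝ) < n - 2 * f := by linarith
    have h2 : (0 : ℝ) < n - f := by linarith
    positivity
  have hA : ∀ ε : ℝ, 0 < ε →
      ‖F (ulbX n f e ε) - meanVec (ulbX n f e ε) S0‖ ^ 2 ≤ K * varVec (ulbX n f e ε) S0 :=
    fun ε hε => (hcon _ S0 (ulb_card_ge n f (by omega)) (ulb_var0_pos n f hf hn e he ε hε)).le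
  have hB : ∀ ε : ℝ, ‖F (ulbX n f e ε) - ((f : ℝ) / ((n : ℝ) - f)) • e‖ ^ 2 ≤ K * V := by
    intro ε
    have hv := ulb_var1 n f hf hn e he ε
    have := hcon (ulbX n f e ε) S1 (ulb_card_lt n (n - f) (by omega)) (by rw [hv]; exact hVpos)
    rw [hv, ulb_mean1 n f hf hn] at this
    exact this.le
  have hsub : Filter.Tendsto (fun ε : ℝ => ‖F (ulbX n f e ε) - meanVec (ulbX n f e ε) S0‖ ^ 2)
      (nhdsWithin 0 (Set.Ioi 0)) (nhds 0) := by
    have hv : Filter.Tendsto (fun ε : ℝ => K * varVec (ulbX n f e ε) S0)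
        (nhdsWithin 0 (Set.Ioi 0)) (nhds 0) := by
      have := ((ulb_cont_var n f e S0).tendsto 0).const_mul K
      rw [ulb_var0, mul_zero] at this
      exact this.mono_left nhdsWithin_le_nhds
    refine tendsto_of_tendsto_of_tendsto_of_le_of_le' tendsto_const_nhds hv
      (Filter.Eventually.of_forall fun ε => by positivity) ?_
    filter_upwards [self_mem_nhdsWithin] with ε hε using hA ε hε
  have hF0 : Filter.Tendsto (fun ε : ℝ => F (ulbX n f e ε) - meanVec (ulbX n f e ε) S0)
      (nhdsWithin 0 (Set.Ioi 0)) (nhds 0) := by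
    rw [tendsto_zero_iff_norm_tendsto_zero]
    have := hsub.sqrt
    simpa using this
  have hm : Filter.Tendsto (fun ε : ℝ => meanVec (ulbX n f e ε) S0)
      (nhdsWithin 0 (Set.Ioi 0)) (nhds 0) := by
    have := (ulb_cont_mean n f e S0).tendsto 0
    rw [ulb_mean0] at this
    exact this.mono_left nhdsWithin_le_nhds
  have hF : Filter.Tendsto (fun ε : ℝ => F (ulbX n f e ε))
      (nhdsWithin 0 (Set.Ioi 0)) (nhds 0) := by
    simpa using hF0.add hm
  have hlim := le_of_tendsto' ((hF.sub_const (((f : ℝ) / ((n : ℝ) - f)) • e)).norm.pow 2) hB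
  rw [zero_sub, norm_neg, norm_smul, he, mul_one, Real.norm_eq_abs, sq_abs] at hlim
  have hKV : K * V = ((f : ℝ) / ((n : ℝ) - f)) ^ 2 - δ * V := by
    have h1 : (n : ℝ) - 2 * f ≠ 0 := by linarith
    have h2 : (n : ℝ) - f ≠ 0 := by linarith
    rw [hK, sub_mul, hV]
    congr 1
    have h3 : (n : ℝ) - f * 2 ≠ 0 := by linarith
    field_simp
  rw [hKV] at hlim
  have := mul_pos hδ hVpos
  linarith
end

section
/- Let d ≥ 1 and let n, f, m be integers with f ≥ 0, n > 2f, and 1 ≤ m ≤ n−f. For all vectors x_1,…,x_n ∈ ℝ^d, every neighbor selection N with associated score s, every m-MultiKrum selection S*_m, and every set S ⊆ {1,…,n} with |S| = n−f, one has ‖x̄_{S*_m} − x̄_S‖² ≤ ((n−f)/(n−2f)) · min( (√2 + 1)², (√(n−2f)/√m + √(2f)/√m + f/m)² ) · Σ_S. In particular m-MultiKrum is a robust aggregation rule. -/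
open Finset

/-- Averages: the smallest elements have the smallest average. -/
theorem mk_avg {ι : Type*} [DecidableEq ι] (g : ι → ℝ) (A B : Finset ι)
    (hA : A.Nonempty) (hAB : A.card ≤ B.card) (h : ∀ i ∈ A, ∀ j ∉ A, g i ≤ g j) :
    (B.card : ℝ) * ∑ i ∈ A, g i ≤ (A.card : ℝ) * ∑ i ∈ B, g i := by
  obtain ⟨a, ha, hmax⟩ := A.exists_max_image g hA
  have h1 : ∑ i ∈ A, (g i - g a) ≤ ∑ i ∈ B, (g i - g a) := by
    rw [← Finset.sum_inter_add_sum_sdiff A B, ← Finset.sum_inter_add_sum_sdiff B A,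
      Finset.inter_comm B A]
    have e1 : ∑ i ∈ A \ B, (g i - g a) ≤ 0 := Finset.sum_nonpos (fun i hi => by
      have := hmax i (Finset.mem_sdiff.1 hi).1
      linarith)
    have e2 : 0 ≤ ∑ i ∈ B \ A, (g i - g a) := Finset.sum_nonneg (fun i hi => by
      have := h a ha i (Finset.mem_sdiff.1 hi).2
      linarith)
    linarith
  have h2 : ∑ i ∈ A, (g i - g a) ≤ 0 := Finset.sum_nonpos (fun i hi => by
    have := hmax i hi
    linarith)
  have hc : (A.card : ℝ) ≤ B.card := by exact_mod_cast hAB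
  have h0 : (0 : ℝ) ≤ A.card := Nat.cast_nonneg _
  have h3 := mul_le_mul_of_nonneg_left h1 h0
  have h4 := mul_le_mul_of_nonpos_right hc h2
  simp only [Finset.sum_sub_distrib, Finset.sum_const, nsmul_eq_mul] at h3 h4
  nlinarith

/-- Cauchy-Schwarz. -/
theorem mk_cs {ι : Type*} (g : ι → ℝ) (A : Finset ι) :
    ∑ i ∈ A, g i ≤ √(A.card : ℝ) * √(∑ i ∈ A, g i ^ 2) := by
  rw [← Real.sqrt_mul (Nat.cast_nonneg _)]
  exact Real.le_sqrt_of_sq_le sq_sum_le_card_mul_sum_sq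

theorem mk_sum_sq {d n : ℕ} (x : Fin n → EuclideanSpace ℝ (Fin d)) (S : Finset (Fin n))
    (hS : S.Nonempty) (y : EuclideanSpace ℝ (Fin d)) :
    ∑ j ∈ S, ‖y - x j‖ ^ 2
      = ∑ j ∈ S, ‖x j - meanVec x S‖ ^ 2 + S.card * ‖y - meanVec x S‖ ^ 2 := by
  have hz : ∑ j ∈ S, (x j - meanVec x S) = 0 := by
    have : (S.card : ℝ) ≠ 0 := by exact_mod_cast hS.card_pos.ne'
    rw [Finset.sum_sub_distrib, Finset.sum_const, meanVec, ← Nat.cast_smul_eq_nsmul ℝ, smul_smul,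
      mul_inv_cancel₀ this, one_smul, sub_self]
  have he : ∀ j ∈ S, ‖y - x j‖ ^ 2 = ‖x j - meanVec x S‖ ^ 2 + ‖y - meanVec x S‖ ^ 2
      - 2 * inner ℝ (y - meanVec x S) (x j - meanVec x S) := by
    intro j _
    have : y - x j = (y - meanVec x S) - (x j - meanVec x S) := by abel
    rw [this, norm_sub_sq_real]
    ring
  rw [Finset.sum_congr rfl he, Finset.sum_sub_distrib, Finset.sum_add_distrib, ← Finset.mul_sum,
    ← inner_sum, hz, inner_zero_right, Finset.sum_const, nsmul_eq_mul]
  ring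

theorem mk_dist {d n : ℕ} (x : Fin n → EuclideanSpace ℝ (Fin d)) (M S : Finset (Fin n))
    (y μ : EuclideanSpace ℝ (Fin d)) (r : ℝ) (hr0 : 0 < r) (hr : r ≤ (M ∩ S).card) :
    √r * ‖y - μ‖ ≤ √(∑ j ∈ M, ‖y - x j‖ ^ 2) + √(∑ j ∈ S, ‖x j - μ‖ ^ 2) := by
  set A := M ∩ S with hA
  have ha : (0 : ℝ) < √(A.card : ℝ) := Real.sqrt_pos.2 (hr0.trans_le hr)
  have h1 : (A.card : ℝ) * ‖y - μ‖ ≤ ∑ j ∈ A, ‖y - x j‖ + ∑ j ∈ A, ‖x j - μ‖ := by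
    rw [← Finset.sum_add_distrib, ← nsmul_eq_mul, ← Finset.sum_const]
    refine Finset.sum_le_sum (fun j _ => ?_)
    have : y - μ = (y - x j) + (x j - μ) := by abel
    rw [this]
    exact norm_add_le _ _
  have h2 := mk_cs (fun j => ‖y - x j‖) A
  have h3 := mk_cs (fun j => ‖x j - μ‖) A
  have h4 : √(∑ j ∈ A, ‖y - x j‖ ^ 2) ≤ √(∑ j ∈ M, ‖y - x j‖ ^ 2) :=
    Real.sqrt_le_sqrt (Finset.sum_le_sum_of_subset_of_nonneg Finset.inter_subset_left
      (fun _ _ _ => by positivity))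
  have h5 : √(∑ j ∈ A, ‖x j - μ‖ ^ 2) ≤ √(∑ j ∈ S, ‖x j - μ‖ ^ 2) :=
    Real.sqrt_le_sqrt (Finset.sum_le_sum_of_subset_of_nonneg Finset.inter_subset_right
      (fun _ _ _ => by positivity))
  have h6 : √(A.card : ℝ) * (√(A.card : ℝ) * ‖y - μ‖) ≤ √(A.card : ℝ) *
      (√(∑ j ∈ M, ‖y - x j‖ ^ 2) + √(∑ j ∈ S, ‖x j - μ‖ ^ 2)) := by
    rw [← mul_assoc, Real.mul_self_sqrt (Nat.cast_nonneg _)]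
    have := mul_le_mul_of_nonneg_left h4 ha.le
    have := mul_le_mul_of_nonneg_left h5 ha.le
    linarith
  have h7 := le_of_mul_le_mul_left h6 ha
  exact (mul_le_mul_of_nonneg_right (Real.sqrt_le_sqrt hr) (norm_nonneg _)).trans h7

/-- Final upper bound on the robustness coefficient of m-MultiKrum:
the minimum of the constant bound and the decreasing bound. -/
theorem multikrum_final_upper_bound {d : ℕ} (hd : 1 ≤ d) (n f m : ℕ)
    (hn : 2 * f < n) (hm1 : 1 ≤ m) (hm2 : m ≤ n - f)
    (x : Fin n → EuclideanSpace ℝ (Fin d))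
    (N : EuclideanSpace ℝ (Fin d) → Finset (Fin n)) (hN : IsNbhdSel f x N)
    (Sm : Finset (Fin n)) (hSm : IsMultiKrumSel m x (score f x N) Sm)
    (S : Finset (Fin n)) (hS : S.card = n - f) :
    ‖meanVec x Sm - meanVec x S‖ ^ 2 ≤
      (((n : ℝ) - f) / ((n : ℝ) - 2 * f)) *
        min ((Real.sqrt 2 + 1) ^ 2)
          ((Real.sqrt ((n : ℝ) - 2 * f) / Real.sqrt m
            + Real.sqrt (2 * f) / Real.sqrt m + (f : ℝ) / m) ^ 2) *
        varVec x S := by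
  classical
  obtain ⟨hSmc, hSms⟩ := hSm
  have hfn : f ≤ n := by omega
  have hkc : ((n - f : ℕ) : ℝ) = (n : ℝ) - f := by push_cast [hfn]; ring
  have hnr : 2 * (f : ℝ) < n := by exact_mod_cast hn
  have hf0 : (0 : ℝ) ≤ f := Nat.cast_nonneg _
  set k : ℝ := (n : ℝ) - f with hk
  set r : ℝ := (n : ℝ) - 2 * f with hr
  have hr0 : 0 < r := by rw [hr]; linarith
  have hk0 : 0 < k := by rw [hk]; linarith
  have hm0 : (0 : ℝ) < m := by exact_mod_cast hm1
  have hSk : (S.card : ℝ) = k := by rw [hS, hkc]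
  have hSne : S.Nonempty := by rw [← Finset.card_pos]; omega
  have hSmne : Sm.Nonempty := by rw [← Finset.card_pos]; omega
  set μ := meanVec x S with hμ
  set Q : ℝ := ∑ j ∈ S, ‖x j - μ‖ ^ 2 with hQ
  have hQ0 : 0 ≤ Q := Finset.sum_nonneg (fun _ _ => by positivity)
  set T : Fin n → ℝ := fun i => ∑ j ∈ N (x i), ‖x i - x j‖ ^ 2 with hT
  have hT0 : ∀ i, 0 ≤ T i := fun i => Finset.sum_nonneg (fun _ _ => by positivity)
  -- scores of points of S
  have hTS : ∀ i, T i ≤ Q + k * ‖x i - μ‖ ^ 2 := by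
    intro i
    have h1 := mk_avg (fun j => ‖x i - x j‖ ^ 2) (N (x i)) S
      (by rw [← Finset.card_pos, (hN (x i)).1]; omega) (by rw [(hN (x i)).1, hS])
      (fun a ha b hb => by
        have := (hN (x i)).2 a ha b hb
        gcongr)
    rw [(hN (x i)).1, hS, hkc, mk_sum_sq x S hSne, hSk] at h1
    exact le_of_mul_le_mul_left h1 hk0
  have hTsum : ∑ i ∈ Sm, T i ≤ m * (2 * Q) := by
    have h1 := mk_avg T Sm S hSmne (by omega) (fun a ha b hb => by
      have := hSms a ha b hb
      unfold score at this
      exact le_of_mul_le_mul_left this (inv_pos.2 hk0))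
    have h2 : ∑ i ∈ S, T i ≤ k * (2 * Q) := by
      refine (Finset.sum_le_sum (fun i _ => hTS i)).trans (le_of_eq ?_)
      rw [Finset.sum_add_distrib, ← Finset.mul_sum, Finset.sum_const, nsmul_eq_mul, hSk]
      ring
    rw [hSk, hSmc] at h1
    have h3 := mul_le_mul_of_nonneg_left h2 hm0.le
    refine le_of_mul_le_mul_left (h1.trans (h3.trans (le_of_eq ?_))) hk0
    ring
  have hdist : ∀ i, √r * ‖x i - μ‖ ≤ √(T i) + √Q := by
    intro i
    refine mk_dist x (N (x i)) S (x i) μ r hr0 ?_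
    have h1 := Finset.card_union_add_card_inter (N (x i)) S
    have h2 := Finset.card_le_univ (N (x i) ∪ S)
    rw [Fintype.card_fin] at h2
    rw [(hN (x i)).1, hS] at h1
    have h3 : n ≤ (N (x i) ∩ S).card + 2 * f := by omega
    have h4 : (n : ℝ) ≤ (N (x i) ∩ S).card + 2 * f := by exact_mod_cast h3
    rw [hr]; linarith
  have hB : ∀ B ⊆ Sm, √r * ∑ i ∈ B, ‖x i - μ‖
      ≤ √(B.card : ℝ) * √(m * (2 * Q)) + B.card * √Q := by
    intro B hBS
    rw [Finset.mul_sum]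
    refine (Finset.sum_le_sum (fun i _ => hdist i)).trans ?_
    rw [Finset.sum_add_distrib, Finset.sum_const, nsmul_eq_mul]
    have h1 := mk_cs (fun i => √(T i)) B
    have h2 : ∑ i ∈ B, √(T i) ^ 2 ≤ m * (2 * Q) := by
      refine le_trans ?_ hTsum
      rw [Finset.sum_congr rfl (fun i _ => Real.sq_sqrt (hT0 i))]
      exact Finset.sum_le_sum_of_subset_of_nonneg hBS (fun i _ _ => hT0 i)
    have h3 := mul_le_mul_of_nonneg_left (Real.sqrt_le_sqrt h2) (Real.sqrt_nonneg (B.card : ℝ))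
    linarith
  set D := ‖meanVec x Sm - μ‖ with hD
  have hmD : (m : ℝ) * D ≤ ∑ i ∈ Sm, ‖x i - μ‖ := by
    have h1 : (m : ℝ) • (meanVec x Sm - μ) = ∑ i ∈ Sm, (x i - μ) := by
      rw [Finset.sum_sub_distrib, Finset.sum_const, meanVec, hSmc, smul_sub, smul_smul,
        mul_inv_cancel₀ hm0.ne', one_smul, Nat.cast_smul_eq_nsmul]
    have h2 : (m : ℝ) * D = ‖(m : ℝ) • (meanVec x Sm - μ)‖ := by
      rw [norm_smul, Real.norm_of_nonneg hm0.le]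
    rw [h2, h1]
    exact norm_sum_le _ _
  have hsr : 0 < √r := Real.sqrt_pos.2 hr0
  have hsm : 0 < √(m : ℝ) := Real.sqrt_pos.2 hm0
  have hsmm : √(m : ℝ) * √(m : ℝ) = m := Real.mul_self_sqrt hm0.le
  have hsQ : 0 ≤ √Q := Real.sqrt_nonneg _
  have hs2 : √((m : ℝ) * (2 * Q)) = √(m : ℝ) * (√2 * √Q) := by
    rw [Real.sqrt_mul hm0.le, Real.sqrt_mul (by norm_num)]
  have key : ∀ C : ℝ, √r * (m * D) ≤ m * (C * √Q) →
      D ^ 2 ≤ k / r * C ^ 2 * varVec x S := by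
    intro C hC
    have h1 : √r * D ≤ C * √Q := by
      refine le_of_mul_le_mul_left (le_trans (le_of_eq ?_) hC) hm0
      ring
    have h2 : (√r * D) ^ 2 ≤ (C * √Q) ^ 2 :=
      pow_le_pow_left₀ (mul_nonneg hsr.le (norm_nonneg _)) h1 2
    rw [mul_pow, mul_pow, Real.sq_sqrt hr0.le, Real.sq_sqrt hQ0] at h2
    have h3 : k / r * C ^ 2 * varVec x S = C ^ 2 * Q / r := by
      unfold varVec
      rw [hSk, ← hμ, ← hQ]
      field_simp
    rw [h3, le_div_iff₀ hr0]
    linarith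
  rcases min_choice ((√2 + 1) ^ 2) ((√r / √(m : ℝ) + √(2 * f) / √(m : ℝ) + (f : ℝ) / m) ^ 2)
    with h | h
  · rw [h]
    apply key
    refine (mul_le_mul_of_nonneg_left hmD hsr.le).trans ((hB Sm subset_rfl).trans (le_of_eq ?_))
    rw [hSmc, hs2, ← mul_assoc, hsmm]
    ring
  · rw [h]
    apply key
    refine (mul_le_mul_of_nonneg_left hmD hsr.le).trans ?_
    rw [← Finset.sum_inter_add_sum_sdiff Sm S, mul_add]
    have hb : (Sm \ S).card ≤ f := by
      have h1 : Sm \ S ⊆ Sᶜ := fun i hi => by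
        rw [Finset.mem_compl]; exact (Finset.mem_sdiff.1 hi).2
      have h2 := Finset.card_le_card h1
      rw [Finset.card_compl, Fintype.card_fin, hS] at h2
      omega
    have hbr : ((Sm \ S).card : ℝ) ≤ f := by exact_mod_cast hb
    have h1 := hB (Sm \ S) Finset.sdiff_subset
    have h2 : ∑ i ∈ Sm ∩ S, ‖x i - μ‖ ≤ √(m : ℝ) * √Q := by
      refine (mk_cs (fun i => ‖x i - μ‖) (Sm ∩ S)).trans ?_
      have hc : ((Sm ∩ S).card : ℝ) ≤ m := by
        rw [← hSmc]
        exact_mod_cast Finset.card_le_card Finset.inter_subset_left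
      exact mul_le_mul (Real.sqrt_le_sqrt hc)
        (Real.sqrt_le_sqrt (Finset.sum_le_sum_of_subset_of_nonneg Finset.inter_subset_right
          (fun _ _ _ => by positivity))) (Real.sqrt_nonneg _) (Real.sqrt_nonneg _)
    have h3 := mul_le_mul_of_nonneg_left h2 hsr.le
    have h4 : √((Sm \ S).card : ℝ) * √(m * (2 * Q)) ≤ √(f : ℝ) * √(m * (2 * Q)) :=
      mul_le_mul_of_nonneg_right (Real.sqrt_le_sqrt hbr) (Real.sqrt_nonneg _)
    have h5 := mul_le_mul_of_nonneg_right hbr hsQ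
    have h6 : (m : ℝ) * ((√r / √(m : ℝ) + √(2 * f) / √(m : ℝ) + (f : ℝ) / m) * √Q)
        = √r * (√(m : ℝ) * √Q) + √(f : ℝ) * √(m * (2 * Q)) + f * √Q := by
      have e : (m : ℝ) / √(m : ℝ) = √(m : ℝ) := Real.div_sqrt
      have e2 : (m : ℝ) * ((√r / √(m : ℝ) + √(2 * f) / √(m : ℝ) + (f : ℝ) / m) * √Q)
        = (√r + √(2 * f)) * ((m : ℝ) / √(m : ℝ)) * √Q + (m / m) * f * √Q := by ring
      rw [e2, e, div_self hm0.ne', hs2, Real.sqrt_mul (by norm_num : (0 : ℝ) ≤ 2)]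
      ring
    rw [h6]
    linarith
end

section
/- Let d ≥ 1 and let n, f be integers with n even, n ≥ 4, f ≥ 1, and n > 2f. Then there exist vectors x_1,…,x_n ∈ ℝ^d (namely n/2 − 1 copies of the first canonical basis vector e and n/2 + 1 copies of 0) and a set S ⊆ {1,…,n} with |S| = n−f and Σ_S > 0 such that for every neighbor selection N with associated score s and every 1-MultiKrum (Krum) selection S*_1 = {i*}, one has ‖x_{i*} − x̄_S‖² ≥ ((n−2)/(n−2f+2)) · Σ_S. Consequently the robustness coefficient κ*_1 of Krum satisfies κ*_1 ≥ (n−2)/(n−2f+2) when n is even. -/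
open Finset

lemma sum_two_pts {d n : ℕ} (e : EuclideanSpace ℝ (Fin d)) (he : ‖e‖ = 1)
    (T A : Finset (Fin n)) (x : Fin n → EuclideanSpace ℝ (Fin d))
    (hx1 : ∀ i ∈ T, x i = e) (hx0 : ∀ i ∉ T, x i = 0) (c : ℝ) :
    ∑ i ∈ A, ‖c • e - x i‖ ^ 2 = ((A ∩ T).card : ℝ) * (c - 1) ^ 2 + ((A \ T).card : ℝ) * c ^ 2 := by
  rw [← Finset.sum_inter_add_sum_sdiff A T]
  congr 1
  · rw [Finset.sum_congr rfl (g := fun _ => (c - 1) ^ 2)]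
    · simp
    · intro i hi
      rw [hx1 i (Finset.mem_inter.1 hi).2]
      have : c • e - e = (c - 1) • e := by rw [sub_smul, one_smul]
      rw [this, norm_smul, he, mul_one, Real.norm_eq_abs, sq_abs]
  · rw [Finset.sum_congr rfl (g := fun _ => c ^ 2)]
    · simp
    · intro i hi
      rw [hx0 i (Finset.mem_sdiff.1 hi).2, sub_zero, norm_smul, he, mul_one, Real.norm_eq_abs, sq_abs]

/-- Krum's lower bound, even case: κ*₁ ≥ (n-2)/(n-2f+2). -/
theorem krum_lower_bound_even {d : ℕ} (hd : 1 ≤ d) (n f : ℕ)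
    (hne : Even n) (hn4 : 4 ≤ n) (hf : 1 ≤ f) (hn : 2 * f < n) :
    ∃ (x : Fin n → EuclideanSpace ℝ (Fin d)) (T S : Finset (Fin n)),
      T.card = n / 2 - 1 ∧
      (∀ i ∈ T, x i = EuclideanSpace.single (⟨0, hd⟩ : Fin d) (1 : ℝ)) ∧
      (∀ i ∉ T, x i = 0) ∧
      S.card = n - f ∧ 0 < varVec x S ∧
      ∀ N, IsNbhdSel f x N →
        ∀ istar : Fin n, IsMultiKrumSel 1 x (score f x N) {istar} →
          ‖x istar - meanVec x S‖ ^ 2 ≥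
            (((n : ℝ) - 2) / ((n : ℝ) - 2 * f + 2)) * varVec x S := by
  obtain ⟨k, hk⟩ := hne
  obtain ⟨T, -, hT⟩ := Finset.exists_subset_card_eq
    (s := (Finset.univ : Finset (Fin n))) (n := n / 2 - 1) (by simp; omega)
  obtain ⟨S, hTS, hS⟩ := Finset.exists_superset_card_eq (s := T) (n := n - f)
    (by omega) (by simp)
  set e : EuclideanSpace ℝ (Fin d) := EuclideanSpace.single (⟨0, hd⟩ : Fin d) (1 : ℝ) with hedef
  have he : ‖e‖ = 1 := by simp [hedef]
  obtain ⟨x, hx⟩ : ∃ x : Fin n → EuclideanSpace ℝ (Fin d), x = fun i => if i ∈ T then e else 0 :=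
    ⟨_, rfl⟩
  have hx1 : ∀ i ∈ T, x i = e := fun i hi => by simp [hx, hi]
  have hx0 : ∀ i ∉ T, x i = 0 := fun i hi => by simp [hx, hi]
  have hsum := fun A => sum_two_pts e he T A x hx1 hx0
  have hTk : T.card = k - 1 := by omega
  have hTr : (T.card : ℝ) = k - 1 := by rw [hTk, Nat.cast_sub (by omega)]; simp
  have hSr : (S.card : ℝ) = 2 * k - f := by
    rw [hS, Nat.cast_sub (by omega), hk]; push_cast; ring
  have hkr : (2 : ℝ) ≤ k := by exact_mod_cast (by omega : 2 ≤ k)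
  have hfk : (f : ℝ) + 1 ≤ k := by exact_mod_cast (by omega : f + 1 ≤ k)
  have hST : ((S \ T).card : ℝ) = k - f + 1 := by
    have := Finset.card_sdiff_add_card_eq_card hTS
    have h2 : ((S \ T).card : ℝ) + T.card = S.card := by exact_mod_cast this
    linarith
  have hSiT : S ∩ T = T := Finset.inter_eq_right.2 hTS
  have hpos : (0 : ℝ) < 2 * k - f := by linarith
  have hmean : meanVec x S = (((k : ℝ) - 1) / (2 * k - f)) • e := by
    have : ∑ i ∈ S, x i = ((k : ℝ) - 1) • e := by
      rw [hx, Finset.sum_ite_mem, hSiT, Finset.sum_const, ← hTr, Nat.cast_smul_eq_nsmul]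
    rw [meanVec, this, hSr, smul_smul, div_eq_inv_mul]
  have hvar : varVec x S = ((k : ℝ) - 1) * (k - f + 1) / (2 * k - f) ^ 2 := by
    rw [varVec]
    simp_rw [norm_sub_rev _ (meanVec x S)]
    rw [hmean, hsum, hSiT, hTr, hST, hSr]
    field_simp
    ring
  refine ⟨x, T, S, hT, hx1, hx0, hS, ?_, ?_⟩
  · rw [hvar]
    have : (0 : ℝ) < k - 1 := by linarith
    have : (0 : ℝ) < k - f + 1 := by linarith
    positivity
  intro N hN i hi
  have hiT : i ∉ T := by
    intro hiT
    obtain ⟨j, hj⟩ : ∃ j, j ∉ T := by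
      by_contra! h
      have : T = univ := Finset.eq_univ_iff_forall.2 h
      have := congrArg Finset.card this
      simp at this
      omega
    have hle := hi.2 i (by simp) j (by simp; rintro rfl; exact hj hiT)
    rw [hx1 i hiT, hx0 j hj] at hle
    have hnf : (0 : ℝ) < ((n : ℝ) - f)⁻¹ := by
      rw [hk]; push_cast; apply inv_pos.2; linarith
    have hle := le_of_mul_le_mul_left hle hnf
    have h1 := hsum (N e) 1
    have h0 := hsum (N 0) 0
    simp only [one_smul, zero_smul] at h1 h0
    rw [h1, h0] at hle
    norm_num at hle
    have hc1 := (hN e).1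
    have hc0 := (hN 0).1
    have a1 := Finset.card_sdiff_add_card_inter (N e) T
    have a0 := Finset.card_sdiff_add_card_inter (N 0) T
    have b1 := Finset.card_le_card (Finset.inter_subset_right : N e ∩ T ⊆ T)
    rcases (N 0 ∩ T).eq_empty_or_nonempty with h | ⟨l, hl⟩
    · rw [h] at hle a0
      rw [Finset.card_empty] at hle
      omega
    · rw [Finset.mem_inter] at hl
      have hsub : Tᶜ ⊆ N 0 \ T := by
        intro m hm
        rw [Finset.mem_compl] at hm
        rw [Finset.mem_sdiff]
        refine ⟨?_, hm⟩
        by_contra hm'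
        have := (hN 0).2 l hl.1 m hm'
        rw [hx1 l hl.2, hx0 m hm] at this
        simp [he] at this
        linarith
      have c0 := Finset.card_le_card hsub
      rw [Finset.card_compl, Fintype.card_fin] at c0
      omega
  have hz := hx0 i hiT
  have e1 : ‖x i - meanVec x S‖ ^ 2 = (((k : ℝ) - 1) / (2 * k - f)) ^ 2 := by
    rw [hz, hmean, zero_sub, norm_neg, norm_smul, he, mul_one, Real.norm_eq_abs, sq_abs]
  rw [e1, hvar, hk]
  push_cast
  apply le_of_eq
  have h3 : (k : ℝ) - f + 1 ≠ 0 := by linarith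
  have h4 : (k : ℝ) + k - 2 * f + 2 = 2 * (k - f + 1) := by ring
  rw [h4]
  field_simp
  ring
end

section
/- Let d ≥ 1 and let n, f be integers with n odd, n ≥ 3, f ≥ 1, and n > 2f. Then there exist vectors x_1,…,x_n ∈ ℝ^d (namely (n−1)/2 copies of the first canonical basis vector e and (n+1)/2 copies of 0) and a set S ⊆ {1,…,n} with |S| = n−f and Σ_S > 0 such that for every neighbor selection N with associated score s and every 1-MultiKrum (Krum) selection S*_1 = {i*}, one has ‖x_{i*} − x̄_S‖² ≥ ((n−1)/(n−2f+1)) · Σ_S. Consequently the robustness coefficient κ*_1 of Krum satisfies κ*_1 ≥ (n−1)/(n−2f+1) when n is odd. -/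
open Finset

/-- Sums over a finite set of a function of a two-valued family. -/
lemma sum_two_valued {n : ℕ} {V M : Type*} [AddCommGroup M] [Module ℝ M]
    (x : Fin n → V) (T A : Finset (Fin n)) (e z : V)
    (hT : ∀ i ∈ T, x i = e) (hT' : ∀ i ∉ T, x i = z) (g : V → M) :
    ∑ i ∈ A, g (x i) = ((A ∩ T).card : ℝ) • g e + ((A \ T).card : ℝ) • g z := by
  rw [← Finset.sum_inter_add_sum_sdiff A T]
  congr 1
  · rw [Finset.sum_congr rfl (g := fun _ => g e)
      (fun i hi => by rw [hT i (Finset.mem_inter.1 hi).2])]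
    rw [Finset.sum_const, Nat.cast_smul_eq_nsmul]
  · rw [Finset.sum_congr rfl (g := fun _ => g z)
      (fun i hi => by rw [hT' i (Finset.mem_sdiff.1 hi).2])]
    rw [Finset.sum_const, Nat.cast_smul_eq_nsmul]

/-- Krum's lower bound, odd case: κ*₁ ≥ (n-1)/(n-2f+1). -/
theorem krum_lower_bound_odd {d : ℕ} (hd : 1 ≤ d) (n f : ℕ)
    (hno : Odd n) (hn3 : 3 ≤ n) (hf : 1 ≤ f) (hn : 2 * f < n) :
    ∃ (x : Fin n → EuclideanSpace ℝ (Fin d)) (T S : Finset (Fin n)),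
      T.card = (n - 1) / 2 ∧
      (∀ i ∈ T, x i = EuclideanSpace.single (⟨0, hd⟩ : Fin d) (1 : ℝ)) ∧
      (∀ i ∉ T, x i = 0) ∧
      S.card = n - f ∧ 0 < varVec x S ∧
      ∀ N, IsNbhdSel f x N →
        ∀ istar : Fin n, IsMultiKrumSel 1 x (score f x N) {istar} →
          ‖x istar - meanVec x S‖ ^ 2 ≥
            (((n : ℝ) - 1) / ((n : ℝ) - 2 * f + 1)) * varVec x S := by
  obtain ⟨k, rfl⟩ := hno
  have hk : 1 ≤ k := by omega
  have hfk : f ≤ k := by omega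
  obtain ⟨T, -, hTc⟩ := Finset.exists_subset_card_eq
    (s := (Finset.univ : Finset (Fin (2 * k + 1)))) (n := k) (by simp; omega)
  obtain ⟨S, hTS, -, hSc⟩ := Finset.exists_subsuperset_card_eq
    (Finset.subset_univ T) (n := 2 * k + 1 - f) (by omega) (by simp)
  set e : EuclideanSpace ℝ (Fin d) := EuclideanSpace.single (⟨0, hd⟩ : Fin d) (1 : ℝ) with he
  have hen : ‖e‖ = 1 := by simp [he]
  let x : Fin (2 * k + 1) → EuclideanSpace ℝ (Fin d) := fun i => if i ∈ T then e else 0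
  have hx1 : ∀ i ∈ T, x i = e := fun i hi => by simp [x, hi]
  have hx0 : ∀ i ∉ T, x i = 0 := fun i hi => by simp [x, hi]
  clear_value x
  have hST : (S ∩ T).card = k := by rw [Finset.inter_eq_right.2 hTS, hTc]
  have hSdT : (S \ T).card = k + 1 - f := by
    have := Finset.card_inter_add_card_sdiff S T
    omega
  have hkR : (1 : ℝ) ≤ k := by exact_mod_cast hk
  have hfR : (f : ℝ) ≤ k := by exact_mod_cast hfk
  have hfR1 : (1 : ℝ) ≤ f := by exact_mod_cast hf
  have hScR : (S.card : ℝ) = 2 * k + 1 - f := by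
    rw [hSc, Nat.cast_sub (by omega)]; push_cast; ring
  have hSdR : ((S \ T).card : ℝ) = k + 1 - f := by
    rw [hSdT, Nat.cast_sub (by omega)]; push_cast; ring
  have hm0 : (0 : ℝ) < 2 * k + 1 - f := by linarith
  have hq0 : (0 : ℝ) < k + 1 - f := by linarith
  set p : ℝ := k / (2 * k + 1 - f) with hp
  have hmean : meanVec x S = p • e := by
    unfold meanVec
    have := sum_two_valued x T S e 0 hx1 hx0 (fun v => v)
    rw [this, hST, hScR, smul_zero, add_zero, smul_smul, hp]
    congr 1
    field_simp
  have hn1 : ‖e - p • e‖ ^ 2 = (1 - p) ^ 2 := by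
    have : e - p • e = (1 - p) • e := by rw [sub_smul, one_smul]
    rw [this, norm_smul, hen, mul_one, Real.norm_eq_abs, sq_abs]
  have hn0 : ‖0 - p • e‖ ^ 2 = p ^ 2 := by
    rw [zero_sub, norm_neg, norm_smul, hen, mul_one, Real.norm_eq_abs, sq_abs]
  have hvar : varVec x S = k * (k + 1 - f) / (2 * k + 1 - f) ^ 2 := by
    unfold varVec
    have := sum_two_valued x T S e 0 hx1 hx0 (fun v => ‖v - p • e‖ ^ 2)
    rw [hmean, this, hST, hScR, hSdR, hn1, hn0, hp, smul_eq_mul, smul_eq_mul]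
    field_simp
    ring
  refine ⟨x, T, S, by omega, hx1, hx0, hSc, ?_, ?_⟩
  · rw [hvar]; positivity
  intro N hN istar hK
  have hi : istar ∉ T := by
    intro hi
    obtain ⟨j, hj⟩ : ∃ j, j ∉ T := by
      by_contra! h
      have := Finset.card_le_card (fun i _ => h i : (Finset.univ : Finset (Fin (2 * k + 1))) ⊆ T)
      simp at this
      omega
    have hle := hK.2 istar (by simp) j (by
      rw [Finset.mem_singleton]; rintro rfl; exact hj hi)
    rw [hx1 _ hi, hx0 _ hj] at hle
    unfold score at hle
    have h1 := sum_two_valued x T (N e) e 0 hx1 hx0 (fun v => ‖e - v‖ ^ 2)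
    have h0 := sum_two_valued x T (N 0) e 0 hx1 hx0 (fun v => ‖0 - v‖ ^ 2)
    rw [h1, h0] at hle
    simp only [sub_self, sub_zero, zero_sub, norm_neg, hen, norm_zero, smul_eq_mul] at hle
    have hpos : (0 : ℝ) < (((2 * k + 1 : ℕ) : ℝ) - f)⁻¹ := by
      push_cast; positivity
    have hle' := le_of_mul_le_mul_left hle hpos
    norm_num at hle'
    have hA := (hN e).1
    have hB := (hN 0).1
    have hA' := Finset.card_inter_add_card_sdiff (N e) T
    have hB' := Finset.card_inter_add_card_sdiff (N 0) T
    have hAT : (N e ∩ T).card ≤ k := (Finset.card_le_card Finset.inter_subset_right).trans hTc.le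
    have hTcc : Tᶜ.card = k + 1 := by
      rw [Finset.card_compl, hTc, Fintype.card_fin]; omega
    have hsub : Tᶜ ⊆ N 0 := by
      intro j hjT
      rw [Finset.mem_compl] at hjT
      by_contra hjN
      have hlt : N 0 ⊂ Tᶜ := by
        refine (Finset.ssubset_iff_of_subset ?_).2 ⟨j, by simpa using hjT, hjN⟩
        intro i hiN
        rw [Finset.mem_compl]
        intro hiT
        have := (hN 0).2 i hiN j hjN
        rw [hx1 _ hiT, hx0 _ hjT] at this
        norm_num [hen] at this
      have := Finset.card_lt_card hlt
      omega
    have hsub' : Tᶜ ⊆ N 0 \ T := fun j hj =>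
      Finset.mem_sdiff.2 ⟨hsub hj, Finset.mem_compl.1 hj⟩
    have := Finset.card_le_card hsub'
    omega
  rw [hx0 _ hi, hmean, hn0, hvar, hp]
  apply le_of_eq
  have : ((2 * k + 1 : ℕ) : ℝ) - 2 * f + 1 = 2 * (k + 1 - f) := by push_cast; ring
  rw [this]
  push_cast
  field_simp
  ring
end

section
/- Let d ≥ 1 and let n, f be integers with f ≥ 1 and n > 3f. For every δ > 0 there exist vectors x_1,…,x_n ∈ ℝ^d and a set S ⊆ {1,…,n} with |S| = n−f and Σ_S > 0 such that for every neighbor selection N with associated score s and every (n−f)-MultiKrum selection S*_{n−f}, one has ‖x̄_{S*_{n−f}} − x̄_S‖² ≥ (4f/(n−2f) − δ) · Σ_S. Consequently the robustness coefficient κ*_{n−f} of (n−f)-MultiKrum satisfies κ*_{n−f} ≥ 4f/(n−2f). -/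
open Finset

lemma mk_sum_le {n : ℕ} (g : Fin n → ℝ) (P T : Finset (Fin n)) (hc : P.card = T.card)
    (h : ∀ i ∈ P, ∀ j ∉ P, g i ≤ g j) : ∑ i ∈ P, g i ≤ ∑ i ∈ T, g i := by
  have h1 := Finset.sum_sdiff (f := g) (Finset.inter_subset_left : P ∩ T ⊆ P)
  have h2 := Finset.sum_sdiff (f := g) (Finset.inter_subset_right : P ∩ T ⊆ T)
  rw [Finset.sdiff_inter_self_left] at h1
  rw [Finset.sdiff_inter_self_right] at h2
  have hcc : (P \ T).card = (T \ P).card := Finset.card_sdiff_comm hc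
  suffices ∑ i ∈ P \ T, g i ≤ ∑ i ∈ T \ P, g i by linarith
  rcases (P \ T).eq_empty_or_nonempty with he | hne
  · have : T \ P = ∅ := by
      rw [← Finset.card_eq_zero, ← hcc, he, Finset.card_empty]
    rw [he, this]
  · obtain ⟨k, hk, hmax⟩ := Finset.exists_max_image (P \ T) g hne
    calc ∑ i ∈ P \ T, g i ≤ (P \ T).card • g k := Finset.sum_le_card_nsmul _ _ _ hmax
      _ = (T \ P).card • g k := by rw [hcc]
      _ ≤ _ := Finset.card_nsmul_le_sum _ _ _ (fun j hj =>
          h k (Finset.mem_sdiff.1 hk).1 j (Finset.mem_sdiff.1 hj).2)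

lemma mk_partition (n f : ℕ) (hn : 3 * f < n) :
    ∃ A B C : Finset (Fin n), A.card = f ∧ B.card = f ∧ C.card = n - 2 * f ∧
      Disjoint A B ∧ Disjoint A C ∧ Disjoint B C ∧ ∀ i, i ∈ A ∨ i ∈ B ∨ i ∈ C := by
  obtain ⟨A, -, hA⟩ := Finset.exists_subset_card_eq (s := (Finset.univ : Finset (Fin n)))
    (n := f) (by rw [Finset.card_univ, Fintype.card_fin]; omega)
  obtain ⟨B, hBA, hB⟩ := Finset.exists_subset_card_eq (s := Aᶜ)
    (n := f) (by rw [Finset.card_compl, Fintype.card_fin]; omega)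
  have hAB : Disjoint A B := by
    rw [Finset.disjoint_left]
    intro i hi hi'
    exact (Finset.mem_compl.1 (hBA hi')) hi
  refine ⟨A, B, (A ∪ B)ᶜ, hA, hB, ?_, hAB, ?_, ?_, ?_⟩
  · rw [Finset.card_compl, Finset.card_union_of_disjoint hAB, Fintype.card_fin]; omega
  · rw [Finset.disjoint_left]; intro i hi; simp [hi]
  · rw [Finset.disjoint_left]; intro i hi; simp [hi]
  · intro i; simp only [Finset.mem_compl, Finset.mem_union]; tauto

/-- (n-f)-MultiKrum's lower bound: κ*_{n-f} ≥ 4f/(n-2f) for n > 3f. -/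
theorem multikrum_nf_lower_bound {d : ℕ} (hd : 1 ≤ d) (n f : ℕ)
    (hf : 1 ≤ f) (hn : 3 * f < n) (δ : ℝ) (hδ : 0 < δ) :
    ∃ (x : Fin n → EuclideanSpace ℝ (Fin d)) (S : Finset (Fin n)),
      S.card = n - f ∧ 0 < varVec x S ∧
      ∀ N, IsNbhdSel f x N →
        ∀ Sm, IsMultiKrumSel (n - f) x (score f x N) Sm →
          ‖meanVec x Sm - meanVec x S‖ ^ 2 ≥
            (4 * (f : ℝ) / ((n : ℝ) - 2 * f) - δ) * varVec x S := by
  obtain ⟨A, B, C, hA, hB, hC, hAB, hAC, hBC, hcov⟩ := mk_partition n f hn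
  obtain ⟨ε, hε0, hε1, hεδ⟩ : ∃ ε : ℝ, 0 < ε ∧ ε ≤ 1 / 2 ∧ 4 * ε ≤ δ :=
    ⟨min (1 / 2) (δ / 4), by positivity, min_le_left _ _, by
      have := min_le_right (1 / 2 : ℝ) (δ / 4); linarith⟩
  set e : EuclideanSpace ℝ (Fin d) := EuclideanSpace.single ⟨0, hd⟩ 1 with he
  have hne : ‖e‖ = 1 := by simp [he]
  have hns : ∀ r : ℝ, ‖r • e‖ ^ 2 = r ^ 2 := by
    intro r; rw [norm_smul, hne, mul_one, Real.norm_eq_abs, sq_abs]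
  set c : Fin n → ℝ := fun i => if i ∈ A then -1 else if i ∈ B then 1 - ε else 0 with hc
  have cA : ∀ i ∈ A, c i = -1 := by intro i hi; simp [hc, hi]
  have cB : ∀ i ∈ B, c i = 1 - ε := by
    intro i hi
    have : i ∉ A := fun h => Finset.disjoint_left.1 hAB h hi
    simp [hc, hi, this]
  have cC : ∀ i ∈ C, c i = 0 := by
    intro i hi
    have h1 : i ∉ A := fun h => Finset.disjoint_left.1 hAC h hi
    have h2 : i ∉ B := fun h => Finset.disjoint_left.1 hBC h hi
    simp [hc, h1, h2]
  clear_value c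
  have hnf : (f : ℝ) + 1 ≤ (n : ℝ) - 2 * f := by
    have : ((3 * f + 1 : ℕ) : ℝ) ≤ n := by exact_mod_cast hn
    push_cast at this; linarith
  have hf' : (1 : ℝ) ≤ f := by exact_mod_cast hf
  have hCr : (C.card : ℝ) = (n : ℝ) - 2 * f := by
    rw [hC, Nat.cast_sub (by omega)]; push_cast; ring
  have hnfr : ((n - f : ℕ) : ℝ) = (n : ℝ) - f := Nat.cast_sub (by omega)
  have sA : ∀ g : ℝ → ℝ, ∑ i ∈ A, g (c i) = f * g (-1) := by
    intro g
    rw [Finset.sum_congr rfl (fun i hi => by rw [cA i hi]), Finset.sum_const, hA, nsmul_eq_mul]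
  have sB : ∀ g : ℝ → ℝ, ∑ i ∈ B, g (c i) = f * g (1 - ε) := by
    intro g
    rw [Finset.sum_congr rfl (fun i hi => by rw [cB i hi]), Finset.sum_const, hB, nsmul_eq_mul]
  have sC : ∀ g : ℝ → ℝ, ∑ i ∈ C, g (c i) = ((n : ℝ) - 2 * f) * g 0 := by
    intro g
    rw [Finset.sum_congr rfl (fun i hi => by rw [cC i hi]), Finset.sum_const, nsmul_eq_mul, hCr]
  have hScard : (A ∪ C).card = n - f := by
    rw [Finset.card_union_of_disjoint hAC, hA, hC]; omega
  have hTcard : (B ∪ C).card = n - f := by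
    rw [Finset.card_union_of_disjoint hBC, hB, hC]; omega
  have hmS : meanVec (fun i => c i • e) (A ∪ C) = (-(f / ((n : ℝ) - f))) • e := by
    have h1 := sA id
    have h2 := sC id
    simp only [id] at h1 h2
    rw [meanVec, hScard, hnfr, ← Finset.sum_smul, smul_smul, Finset.sum_union hAC, h1, h2]
    congr 1; ring
  have hmT : meanVec (fun i => c i • e) (B ∪ C) = (f * (1 - ε) / ((n : ℝ) - f)) • e := by
    have h1 := sB id
    have h2 := sC id
    simp only [id] at h1 h2
    rw [meanVec, hTcard, hnfr, ← Finset.sum_smul, smul_smul, Finset.sum_union hBC, h1, h2]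
    congr 1; ring
  have hpos : 0 < (n : ℝ) - f := by linarith
  have hpos2 : 0 < (n : ℝ) - 2 * f := by linarith
  have hv : varVec (fun i => c i • e) (A ∪ C) = f * ((n : ℝ) - 2 * f) / ((n : ℝ) - f) ^ 2 := by
    rw [varVec, hmS, hScard, hnfr]
    simp only [← sub_smul, hns]
    rw [Finset.sum_union hAC, sA (fun t => (t - -(f / ((n : ℝ) - f))) ^ 2),
      sC (fun t => (t - -(f / ((n : ℝ) - f))) ^ 2)]
    field_simp
    ring
  refine ⟨fun i => c i • e, A ∪ C, hScard, ?_, ?_⟩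
  · rw [hv]; positivity
  intro N hN Sm hSm
  have hup : ∀ i ∈ B ∪ C, ∑ j ∈ N (c i • e), ‖c i • e - c j • e‖ ^ 2
      ≤ ((n : ℝ) - 2 * f) * (1 - ε) ^ 2 := by
    intro i hi
    have hb := mk_sum_le (fun j => ‖c i • e - c j • e‖ ^ 2) (N (c i • e)) (B ∪ C)
      (by rw [hTcard]; exact (hN _).1)
      (fun a ha b hb => pow_le_pow_left₀ (norm_nonneg _) ((hN (c i • e)).2 a ha b hb) 2)
    refine hb.trans ?_
    simp only [← sub_smul, hns]
    rw [Finset.sum_union hBC, sB (fun t => (c i - t) ^ 2), sC (fun t => (c i - t) ^ 2)]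
    rcases Finset.mem_union.1 hi with h | h
    · rw [cB i h]; apply le_of_eq; ring
    · rw [cC i h]
      nlinarith [sq_nonneg (1 - ε)]
  have hlow : ∀ i ∈ A, ((n : ℝ) - 2 * f) ≤ ∑ j ∈ N (c i • e), ‖c i • e - c j • e‖ ^ 2 := by
    intro i hi
    simp only [← sub_smul, hns]
    have hcard : ((n : ℝ) - 2 * f) ≤ ((N (c i • e) \ A).card : ℝ) := by
      have h1 := Finset.le_card_sdiff A (N (c i • e))
      rw [(hN _).1, hA] at h1
      have h2 : n ≤ (N (c i • e) \ A).card + 2 * f := by omega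
      have h3 : (n : ℝ) ≤ ((N (c i • e) \ A).card : ℝ) + 2 * f := by exact_mod_cast h2
      linarith
    refine hcard.trans ?_
    have h4 := Finset.card_nsmul_le_sum (N (c i • e) \ A) (fun j => (c i - c j) ^ 2) 1 (by
      intro j hj
      have hj' := (Finset.mem_sdiff.1 hj).2
      rcases hcov j with h | h | h
      · exact absurd h hj'
      · simp only [cA i hi, cB j h]; nlinarith
      · simp only [cA i hi, cC j h]; norm_num)
    rw [nsmul_eq_mul, mul_one] at h4
    exact h4.trans (Finset.sum_le_sum_of_subset_of_nonneg Finset.sdiff_subset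
      (fun _ _ _ => sq_nonneg _))
  have hST : Sm = B ∪ C := by
    apply Finset.eq_of_subset_of_card_le _ (by rw [hTcard, hSm.1])
    intro i hi
    by_contra hiT
    have hiA : i ∈ A := by
      rcases hcov i with h | h
      · exact h
      · exact absurd (Finset.mem_union.2 h) hiT
    obtain ⟨j, hj, hjS⟩ : ∃ j ∈ B ∪ C, j ∉ Sm := by
      by_contra! hcon
      have := Finset.eq_of_subset_of_card_le hcon (by rw [hTcard, hSm.1])
      exact hiT (this ▸ hi)
    have hs := hSm.2 i hi j hjS
    simp only [score] at hs
    have hs' := le_of_mul_le_mul_left hs (inv_pos.2 hpos)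
    have h1 := hlow i hiA
    have h2 := hup j hj
    have h3 : (1 - ε) ^ 2 < 1 := by nlinarith
    have h4 := mul_lt_mul_of_pos_left h3 hpos2
    linarith
  rw [hST, hmT, hmS, ← sub_smul, hns, hv]
  have key : (f * (1 - ε) / ((n : ℝ) - f) - -(f / ((n : ℝ) - f))) ^ 2
      = (f * (2 - ε) ^ 2 / ((n : ℝ) - 2 * f)) *
        (f * ((n : ℝ) - 2 * f) / ((n : ℝ) - f) ^ 2) := by
    have hp := hpos.ne'
    have hq := hpos2.ne'
    generalize (n : ℝ) - 2 * f = q at hq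
    generalize (n : ℝ) - f = p at hp
    field_simp
    ring
  rw [key]
  apply mul_le_mul_of_nonneg_right _ (by positivity)
  rw [sub_le_iff_le_add, div_add' _ _ _ hpos2.ne', div_le_div_iff_of_pos_right hpos2]
  have h5 : (f : ℝ) * (4 * ε) ≤ ((n : ℝ) - 2 * f) * δ :=
    mul_le_mul (by linarith) hεδ (by positivity) hpos2.le
  nlinarith [mul_nonneg (by linarith : (0 : ℝ) ≤ f) (sq_nonneg ε)]
end

section
/- Let d ≥ 1 and let n, f, m be integers with f ≥ 0, n > 2f, and 1 ≤ m ≤ n−f. For all vectors x_1,…,x_n ∈ ℝ^d, every neighbor selection N with associated score s, every m-MultiKrum selection S*_m, and every set S ⊆ {1,…,n} with |S| = n−f, one has (1/m) ∑_{i∈S*_m} s(x_i) ≤ 2 Σ_S. -/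
open Finset

theorem sum_smallest_aux {n : ℕ} (A B : Finset (Fin n)) (g : Fin n → ℝ)
    (hA : A.Nonempty) (hc : A.card ≤ B.card)
    (hg : ∀ i ∈ A, ∀ j ∉ A, g i ≤ g j) :
    (B.card : ℝ) * ∑ i ∈ A, g i ≤ (A.card : ℝ) * ∑ i ∈ B, g i := by
  obtain ⟨a, ha, hmax⟩ := A.exists_max_image g hA
  have h1 : ∑ i ∈ A, (g i - g a) ≤ ∑ i ∈ B, (g i - g a) := by
    have e : ∀ C : Finset (Fin n), ∑ i ∈ C, (g i - g a)
        = ∑ i, if i ∈ C then (g i - g a) else 0 := by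
      intro C
      simp [← Finset.sum_filter]
    rw [e A, e B]
    apply Finset.sum_le_sum
    intro i _
    by_cases hiA : i ∈ A
    · have := hmax i hiA
      by_cases hiB : i ∈ B <;> simp only [hiA, hiB, if_true, if_false] <;> linarith
    · have := hg a ha i hiA
      by_cases hiB : i ∈ B <;> simp only [hiA, hiB, if_true, if_false] <;> linarith
  have h2 : ∑ i ∈ A, (g i - g a) ≤ 0 :=
    Finset.sum_nonpos fun i hi => by linarith [hmax i hi]
  simp only [Finset.sum_sub_distrib, Finset.sum_const, nsmul_eq_mul] at h1 h2
  have hc' : (A.card : ℝ) ≤ B.card := by exact_mod_cast hc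
  have hA0 : (0 : ℝ) ≤ A.card := by positivity
  nlinarith [mul_le_mul_of_nonneg_left h1 hA0,
    mul_nonneg (sub_nonneg.2 hc') (sub_nonneg.2 h2)]

theorem sum_pair_aux {d n : ℕ} (x : Fin n → EuclideanSpace ℝ (Fin d))
    (S : Finset (Fin n)) (hS : S.Nonempty) :
    ∑ i ∈ S, ∑ j ∈ S, ‖x i - x j‖ ^ 2
      = 2 * (S.card : ℝ) * ∑ i ∈ S, ‖x i - meanVec x S‖ ^ 2 := by
  have hc : (S.card : ℝ) ≠ 0 := by exact_mod_cast hS.card_pos.ne'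
  have h0 : ∑ i ∈ S, (x i - meanVec x S) = 0 := by
    rw [Finset.sum_sub_distrib, Finset.sum_const, ← Nat.cast_smul_eq_nsmul ℝ, meanVec,
      smul_smul, mul_inv_cancel₀ hc, one_smul, sub_self]
  have e : ∀ i j, ‖x i - x j‖ ^ 2 = ‖x i - meanVec x S‖ ^ 2
      - 2 * inner ℝ (x i - meanVec x S) (x j - meanVec x S) + ‖x j - meanVec x S‖ ^ 2 := by
    intro i j
    rw [← norm_sub_sq_real, sub_sub_sub_cancel_right]
  simp only [e, Finset.sum_add_distrib, Finset.sum_sub_distrib, ← Finset.mul_sum, ← inner_sum, h0,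
    inner_zero_right, Finset.sum_const, nsmul_eq_mul]
  simp
  ring

/-- The average score over an m-MultiKrum selection is at most twice
the variance of any set of n-f indices. -/
theorem avg_score_le_two_var {d : ℕ} (hd : 1 ≤ d) (n f m : ℕ)
    (hn : 2 * f < n) (hm1 : 1 ≤ m) (hm2 : m ≤ n - f)
    (x : Fin n → EuclideanSpace ℝ (Fin d))
    (N : EuclideanSpace ℝ (Fin d) → Finset (Fin n)) (hN : IsNbhdSel f x N)
    (Sm : Finset (Fin n)) (hSm : IsMultiKrumSel m x (score f x N) Sm)
    (S : Finset (Fin n)) (hS : S.card = n - f) :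
    (m : ℝ)⁻¹ * ∑ i ∈ Sm, score f x N (x i) ≤ 2 * varVec x S := by
  have hfn : f ≤ n := by omega
  have hk : ((n : ℝ) - f) = (S.card : ℝ) := by rw [hS, Nat.cast_sub hfn]
  have hS0 : S.Nonempty := Finset.card_pos.1 (by omega)
  have hSp : (0 : ℝ) < S.card := by exact_mod_cast hS0.card_pos
  have hmp : (0 : ℝ) < m := by exact_mod_cast hm1
  obtain ⟨hc, hmin⟩ := hSm
  have h1 := sum_smallest_aux Sm S (fun i => score f x N (x i))
    (Finset.card_pos.1 (by omega)) (by omega) hmin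
  rw [hc] at h1
  have h2 : ∀ i, score f x N (x i) ≤ (S.card : ℝ)⁻¹ * ∑ j ∈ S, ‖x i - x j‖ ^ 2 := by
    intro i
    obtain ⟨hcN, hNm⟩ := hN (x i)
    have h := sum_smallest_aux (N (x i)) S (fun j => ‖x i - x j‖ ^ 2)
      (Finset.card_pos.1 (by omega)) (by omega)
      (fun a ha b hb => pow_le_pow_left₀ (norm_nonneg _) (hNm a ha b hb) 2)
    rw [hcN, ← hS] at h
    rw [score, hk]
    exact mul_le_mul_of_nonneg_left (le_of_mul_le_mul_left h hSp) (by positivity)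
  have h3 : ∑ i ∈ S, score f x N (x i) ≤ 2 * ∑ i ∈ S, ‖x i - meanVec x S‖ ^ 2 := by
    refine (Finset.sum_le_sum fun i _ => h2 i).trans (le_of_eq ?_)
    rw [← Finset.mul_sum, sum_pair_aux x S hS0]
    field_simp
  rw [varVec, inv_mul_le_iff₀ hmp]
  have h4 := h1.trans (mul_le_mul_of_nonneg_left h3 hmp.le)
  rw [← le_div_iff₀' hSp] at h4
  refine h4.trans (le_of_eq ?_)
  field_simp
end

section
/- Let d ≥ 1 and let n, f be integers with f ≥ 0 and n > 2f. For all vectors x_1,…,x_n ∈ ℝ^d, every neighbor selection N with associated score s, every set S ⊆ {1,…,n} with |S| = n−f, every point x ∈ ℝ^d, and every real α > 0, one has ‖x − x̄_S‖² ≤ ((n−f)/(n−2f)) · ( (1+α) s(x) + (1 + 1/α) Σ_S ). -/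
open Finset

/-- Control of the distance from any point to the honest mean by its score
and the honest variance. -/
theorem control_dist_to_mean {d : ℕ} (hd : 1 ≤ d) (n f : ℕ) (hn : 2 * f < n)
    (x : Fin n → EuclideanSpace ℝ (Fin d))
    (N : EuclideanSpace ℝ (Fin d) → Finset (Fin n)) (hN : IsNbhdSel f x N)
    (S : Finset (Fin n)) (hS : S.card = n - f)
    (y : EuclideanSpace ℝ (Fin d)) (α : ℝ) (hα : 0 < α) :
    ‖y - meanVec x S‖ ^ 2 ≤
      (((n : ℝ) - f) / ((n : ℝ) - 2 * f)) *
        ((1 + α) * score f x N y + (1 + 1 / α) * varVec x S) := by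
  have hNc := (hN y).1
  set m := meanVec x S with hm
  set T := S ∩ N y with hT
  have hTc : n - 2 * f ≤ T.card := by
    have h1 : (S ∪ N y).card + T.card = S.card + (N y).card :=
      Finset.card_union_add_card_inter S (N y)
    have h2 : (S ∪ N y).card ≤ n := by simpa using Finset.card_le_univ (S ∪ N y)
    omega
  have hTr : (n : ℝ) - 2 * f ≤ T.card := by
    have h : n ≤ T.card + 2 * f := by omega
    have h' : (n : ℝ) ≤ T.card + 2 * f := by exact_mod_cast h
    linarith
  have hn' : 2 * (f : ℝ) < n := by exact_mod_cast hn
  have hf0 : (0 : ℝ) ≤ f := Nat.cast_nonneg f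
  have hp : (0 : ℝ) < n - 2 * f := by linarith
  have hq : (0 : ℝ) < n - f := by linarith
  have hSr : (S.card : ℝ) = n - f := by
    rw [hS, Nat.cast_sub (by omega)]
  have key : ∀ i, ‖y - m‖ ^ 2 ≤ (1 + α) * ‖y - x i‖ ^ 2 + (1 + 1 / α) * ‖x i - m‖ ^ 2 := by
    intro i
    have h1 : ‖y - m‖ ≤ ‖y - x i‖ + ‖x i - m‖ := norm_sub_le_norm_sub_add_norm_sub y (x i) m
    generalize ‖y - x i‖ = a at *
    generalize ‖x i - m‖ = b at *
    have h2 : ‖y - m‖ ^ 2 ≤ (a + b) ^ 2 := pow_le_pow_left₀ (norm_nonneg _) h1 2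
    have h3 : (1 + α) * a ^ 2 + (1 + 1 / α) * b ^ 2 - (a + b) ^ 2 = (α * a - b) ^ 2 / α := by
      field_simp
      ring
    have h4 : 0 ≤ (α * a - b) ^ 2 / α := by positivity
    linarith
  have hsum : (T.card : ℝ) * ‖y - m‖ ^ 2 ≤
      (1 + α) * ∑ i ∈ T, ‖y - x i‖ ^ 2 + (1 + 1 / α) * ∑ i ∈ T, ‖x i - m‖ ^ 2 := by
    have h := Finset.sum_le_sum (s := T) (fun i _ => key i)
    rwa [Finset.sum_const, nsmul_eq_mul, Finset.sum_add_distrib, ← Finset.mul_sum,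
      ← Finset.mul_sum] at h
  have hA : ∑ i ∈ T, ‖y - x i‖ ^ 2 ≤ ∑ i ∈ N y, ‖y - x i‖ ^ 2 :=
    Finset.sum_le_sum_of_subset_of_nonneg Finset.inter_subset_right (fun _ _ _ => by positivity)
  have hB : ∑ i ∈ T, ‖x i - m‖ ^ 2 ≤ ∑ i ∈ S, ‖x i - m‖ ^ 2 :=
    Finset.sum_le_sum_of_subset_of_nonneg Finset.inter_subset_left (fun _ _ _ => by positivity)
  have hA' := mul_le_mul_of_nonneg_left hA (by positivity : 0 ≤ 1 + α)
  have hB' := mul_le_mul_of_nonneg_left hB (by positivity : 0 ≤ 1 + 1 / α)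
  have hC := mul_le_mul_of_nonneg_right hTr (by positivity : 0 ≤ ‖y - m‖ ^ 2)
  have hR : (((n : ℝ) - f) / ((n : ℝ) - 2 * f)) *
        ((1 + α) * score f x N y + (1 + 1 / α) * varVec x S) =
      ((1 + α) * ∑ i ∈ N y, ‖y - x i‖ ^ 2 + (1 + 1 / α) * ∑ i ∈ S, ‖x i - m‖ ^ 2) /
        ((n : ℝ) - 2 * f) := by
    rw [score, varVec, hSr, ← hm]
    generalize ∑ i ∈ N y, ‖y - x i‖ ^ 2 = A
    generalize ∑ i ∈ S, ‖x i - m‖ ^ 2 = B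
    generalize (n : ℝ) - 2 * f = p at *
    generalize (n : ℝ) - f = q at *
    field_simp
  rw [hR, le_div_iff₀ hp]
  linarith
end

section
/- Let d ≥ 1 and let n, f, m be integers with f ≥ 0, n > 2f, and 1 ≤ m ≤ n−f. For all vectors x_1,…,x_n ∈ ℝ^d, every neighbor selection N with associated score s, every m-MultiKrum selection S*_m, and every set S ⊆ {1,…,n} with |S| = n−f, one has ‖x̄_{S*_m} − x̄_S‖² ≤ (√2 + 1)² · ((n−f)/(n−2f)) · Σ_S. That is, the robustness coefficient of m-MultiKrum is at most (√2+1)²(n−f)/(n−2f). -/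
open Finset

theorem sel_avg {n : ℕ} (g : Fin n → ℝ) (A B : Finset (Fin n))
    (h : ∀ i ∈ A, ∀ j ∉ A, g i ≤ g j) (hA : 0 < A.card) (hAB : A.card ≤ B.card) :
    (B.card : ℝ) * ∑ i ∈ A, g i ≤ (A.card : ℝ) * ∑ i ∈ B, g i := by
  obtain ⟨i0, hi0, hmax⟩ := Finset.exists_max_image A g (Finset.card_pos.mp hA)
  have s1 := Finset.sum_inter_add_sum_sdiff A B g
  have s2 := Finset.sum_inter_add_sum_sdiff B A g
  have c1 := Finset.card_inter_add_card_sdiff A B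
  have c2 := Finset.card_inter_add_card_sdiff B A
  rw [Finset.inter_comm] at s2 c2
  have b1 : ∑ i ∈ A \ B, g i ≤ ((A \ B).card : ℝ) * g i0 := by
    rw [← nsmul_eq_mul]
    exact Finset.sum_le_card_nsmul _ _ _ fun i hi => hmax i (Finset.mem_sdiff.mp hi).1
  have b2 : ((B \ A).card : ℝ) * g i0 ≤ ∑ i ∈ B \ A, g i := by
    rw [← nsmul_eq_mul]
    exact Finset.card_nsmul_le_sum _ _ _ fun i hi => h i0 hi0 i (Finset.mem_sdiff.mp hi).2
  have b3 : ∑ i ∈ A, g i ≤ (A.card : ℝ) * g i0 := by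
    rw [← nsmul_eq_mul]
    exact Finset.sum_le_card_nsmul _ _ _ hmax
  have c1' : ((A ∩ B).card : ℝ) + (A \ B).card = A.card := by exact_mod_cast c1
  have c2' : ((A ∩ B).card : ℝ) + (B \ A).card = B.card := by exact_mod_cast c2
  have hAB' : (A.card : ℝ) ≤ B.card := by exact_mod_cast hAB
  have key : ∑ i ∈ A, g i + ((B.card : ℝ) - A.card) * g i0 ≤ ∑ i ∈ B, g i := by
    have : ((B.card : ℝ) - A.card) = (B \ A).card - (A \ B).card := by linarith
    rw [this, sub_mul]; linarith
  have t1 := mul_le_mul_of_nonneg_left key (Nat.cast_nonneg (α := ℝ) A.card)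
  have t2 := mul_le_mul_of_nonneg_left b3 (sub_nonneg.mpr hAB')
  linarith

theorem sum_sub_mean {d n : ℕ} (x : Fin n → EuclideanSpace ℝ (Fin d))
    (A : Finset (Fin n)) (hA : 0 < A.card) : ∑ i ∈ A, (x i - meanVec x A) = 0 := by
  have : (A.card : ℝ) ≠ 0 := by positivity
  rw [Finset.sum_sub_distrib, Finset.sum_const, ← Nat.cast_smul_eq_nsmul ℝ, meanVec,
    smul_inv_smul₀ this, sub_self]

theorem sum_dist {d n : ℕ} (x : Fin n → EuclideanSpace ℝ (Fin d))
    (A : Finset (Fin n)) (μ : EuclideanSpace ℝ (Fin d)) (hA : 0 < A.card) :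
    ∑ i ∈ A, ‖μ - x i‖ ^ 2 =
      A.card * ‖μ - meanVec x A‖ ^ 2 + ∑ i ∈ A, ‖x i - meanVec x A‖ ^ 2 := by
  have h : ∀ i, ‖μ - x i‖ ^ 2 = ‖μ - meanVec x A‖ ^ 2
      - 2 * inner ℝ (μ - meanVec x A) (x i - meanVec x A) + ‖x i - meanVec x A‖ ^ 2 := by
    intro i
    rw [← norm_sub_sq_real, sub_sub_sub_cancel_right]
  simp only [h]
  rw [Finset.sum_add_distrib, Finset.sum_sub_distrib, ← Finset.mul_sum, ← inner_sum,
    sum_sub_mean x A hA]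
  simp

theorem pair_sum {d n : ℕ} (x : Fin n → EuclideanSpace ℝ (Fin d))
    (A : Finset (Fin n)) (hA : 0 < A.card) :
    ∑ i ∈ A, ∑ j ∈ A, ‖x i - x j‖ ^ 2 =
      2 * (A.card : ℝ) * ∑ i ∈ A, ‖x i - meanVec x A‖ ^ 2 := by
  simp only [sum_dist x A _ hA]
  rw [Finset.sum_add_distrib, ← Finset.mul_sum, Finset.sum_const, nsmul_eq_mul]
  ring

theorem mean_dist {d n : ℕ} (x : Fin n → EuclideanSpace ℝ (Fin d))
    (A : Finset (Fin n)) (μ : EuclideanSpace ℝ (Fin d)) (hA : 0 < A.card) :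
    A.card * ‖meanVec x A - μ‖ ^ 2 ≤ ∑ i ∈ A, ‖x i - μ‖ ^ 2 := by
  have h := sum_dist x A μ hA
  simp only [norm_sub_rev μ] at h
  rw [h]
  have : 0 ≤ ∑ i ∈ A, ‖x i - meanVec x A‖ ^ 2 := Finset.sum_nonneg fun _ _ => by positivity
  linarith

/-- Constant upper bound on the robustness coefficient of m-MultiKrum. -/
theorem multikrum_constant_upper_bound {d : ℕ} (hd : 1 ≤ d) (n f m : ℕ)
    (hn : 2 * f < n) (hm1 : 1 ≤ m) (hm2 : m ≤ n - f)
    (x : Fin n → EuclideanSpace ℝ (Fin d))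
    (N : EuclideanSpace ℝ (Fin d) → Finset (Fin n)) (hN : IsNbhdSel f x N)
    (Sm : Finset (Fin n)) (hSm : IsMultiKrumSel m x (score f x N) Sm)
    (S : Finset (Fin n)) (hS : S.card = n - f) :
    ‖meanVec x Sm - meanVec x S‖ ^ 2 ≤
      (Real.sqrt 2 + 1) ^ 2 * (((n : ℝ) - f) / ((n : ℝ) - 2 * f)) * varVec x S := by
  obtain ⟨hmc, hsel⟩ := hSm
  have hfn : f ≤ n := by omega
  have hk : ((n - f : ℕ) : ℝ) = (n : ℝ) - f := by push_cast [hfn]; ring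
  have hkpos : (0 : ℝ) < (n : ℝ) - f := by
    rw [← hk]; exact_mod_cast (by omega : 0 < n - f)
  have hnr : (2 : ℝ) * f < n := by exact_mod_cast hn
  have hqpos : (0 : ℝ) < (n : ℝ) - 2 * f := by linarith
  have hmpos : (0 : ℝ) < m := by exact_mod_cast hm1
  have hSc : (S.card : ℝ) = (n : ℝ) - f := by rw [hS, hk]
  set μ := meanVec x S with hμ
  set V := ∑ i ∈ S, ‖x i - μ‖ ^ 2 with hV
  have hvar : varVec x S = ((n : ℝ) - f)⁻¹ * V := by
    rw [varVec, hSc]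
  set P : Fin n → ℝ := fun i => ∑ j ∈ N (x i), ‖x i - x j‖ ^ 2 with hP
  have hPsel : ∀ i ∈ Sm, ∀ j ∉ Sm, P i ≤ P j := by
    intro i hi j hj
    have := hsel i hi j hj
    unfold score at this
    exact le_of_mul_le_mul_left this (inv_pos.mpr hkpos)
  have h1 := sel_avg P Sm S hPsel (by omega) (by omega)
  have h2 : ∀ i, P i ≤ ∑ j ∈ S, ‖x i - x j‖ ^ 2 := by
    intro i
    obtain ⟨hc, hnb⟩ := hN (x i)
    have := sel_avg (fun j => ‖x i - x j‖ ^ 2) (N (x i)) S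
      (fun a ha b hb => pow_le_pow_left₀ (norm_nonneg _) (hnb a ha b hb) 2) (by omega) (by omega)
    rw [hc, hSc, hk] at this
    exact le_of_mul_le_mul_left this hkpos
  have hpair := pair_sum x S (by omega)
  rw [hSc, ← hμ, ← hV] at hpair
  have h3 : ∑ i ∈ S, P i ≤ 2 * ((n : ℝ) - f) * V := by
    rw [← hpair]; exact Finset.sum_le_sum fun i _ => h2 i
  rw [hSc, hmc] at h1
  have h4 : ∑ i ∈ Sm, P i ≤ m * (2 * V) := by
    have := h1.trans (mul_le_mul_of_nonneg_left h3 hmpos.le)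
    refine le_of_mul_le_mul_left (a := (n : ℝ) - f) ?_ hkpos
    linarith
  have h2pos : (0 : ℝ) < Real.sqrt 2 := by positivity
  have hsq : Real.sqrt 2 * Real.sqrt 2 = 2 := Real.mul_self_sqrt (by norm_num)
  have h5 : ∀ i, ((n : ℝ) - 2 * f) * ‖x i - μ‖ ^ 2 ≤
      (1 + Real.sqrt 2 / 2) * P i + (1 + Real.sqrt 2) * V := by
    intro i
    have hcard : n - 2 * f ≤ (N (x i) ∩ S).card := by
      have := Finset.card_union_add_card_inter (N (x i)) S
      have h' := Finset.card_le_univ (N (x i) ∪ S)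
      rw [Fintype.card_fin] at h'
      have := (hN (x i)).1
      omega
    have hcr : (n : ℝ) - 2 * f ≤ ((N (x i) ∩ S).card : ℝ) := by
      have : n ≤ (N (x i) ∩ S).card + 2 * f := by omega
      have : (n : ℝ) ≤ ((N (x i) ∩ S).card : ℝ) + 2 * f := by exact_mod_cast this
      linarith
    calc ((n : ℝ) - 2 * f) * ‖x i - μ‖ ^ 2
        ≤ ((N (x i) ∩ S).card : ℝ) * ‖x i - μ‖ ^ 2 := by gcongr
      _ = ∑ j ∈ N (x i) ∩ S, ‖x i - μ‖ ^ 2 := by simp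
      _ ≤ ∑ j ∈ N (x i) ∩ S, ((1 + Real.sqrt 2 / 2) * ‖x i - x j‖ ^ 2 +
            (1 + Real.sqrt 2) * ‖x j - μ‖ ^ 2) := by
          refine Finset.sum_le_sum fun j _ => ?_
          have ht : ‖x i - μ‖ ≤ ‖x i - x j‖ + ‖x j - μ‖ := norm_sub_le_norm_sub_add_norm_sub _ _ _
          have ha := norm_nonneg (x i - x j)
          have hb := norm_nonneg (x j - μ)
          generalize ‖x i - x j‖ = a at *
          generalize ‖x j - μ‖ = b at *
          have hle := pow_le_pow_left₀ (norm_nonneg (x i - μ)) ht 2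
          refine hle.trans ?_
          have hs : Real.sqrt 2 ^ 2 = 2 := by rw [sq]; exact hsq
          have key : 0 ≤ (Real.sqrt 2 / 2) * (a - Real.sqrt 2 * b) ^ 2 := by positivity
          have e : (Real.sqrt 2 / 2) * (a - Real.sqrt 2 * b) ^ 2 =
            Real.sqrt 2 / 2 * a ^ 2 - 2 * a * b + Real.sqrt 2 * b ^ 2 := by
            linear_combination (-a * b + Real.sqrt 2 / 2 * b ^ 2) * hs
          linarith
      _ = (1 + Real.sqrt 2 / 2) * ∑ j ∈ N (x i) ∩ S, ‖x i - x j‖ ^ 2 +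
            (1 + Real.sqrt 2) * ∑ j ∈ N (x i) ∩ S, ‖x j - μ‖ ^ 2 := by
          rw [Finset.sum_add_distrib, Finset.mul_sum, Finset.mul_sum]
      _ ≤ _ := by
          have u1 : ∑ j ∈ N (x i) ∩ S, ‖x i - x j‖ ^ 2 ≤ P i :=
            Finset.sum_le_sum_of_subset_of_nonneg Finset.inter_subset_left
              fun _ _ _ => by positivity
          have u2 : ∑ j ∈ N (x i) ∩ S, ‖x j - μ‖ ^ 2 ≤ V :=
            Finset.sum_le_sum_of_subset_of_nonneg Finset.inter_subset_right
              fun _ _ _ => by positivity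
          gcongr
  have h6 : ((n : ℝ) - 2 * f) * ∑ i ∈ Sm, ‖x i - μ‖ ^ 2 ≤
      m * ((Real.sqrt 2 + 1) ^ 2 * V) := by
    calc ((n : ℝ) - 2 * f) * ∑ i ∈ Sm, ‖x i - μ‖ ^ 2
        ≤ ∑ i ∈ Sm, ((1 + Real.sqrt 2 / 2) * P i + (1 + Real.sqrt 2) * V) := by
          rw [Finset.mul_sum]; exact Finset.sum_le_sum fun i _ => h5 i
      _ = (1 + Real.sqrt 2 / 2) * ∑ i ∈ Sm, P i + m * ((1 + Real.sqrt 2) * V) := by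
          rw [Finset.sum_add_distrib, Finset.sum_const, hmc, nsmul_eq_mul, ← Finset.mul_sum]
      _ ≤ (1 + Real.sqrt 2 / 2) * (m * (2 * V)) + m * ((1 + Real.sqrt 2) * V) := by gcongr
      _ = _ := by linear_combination (-m * V) * hsq
  have h7 := mean_dist x Sm μ (by omega)
  rw [hmc] at h7
  rw [hvar]
  have h8 : ((n : ℝ) - 2 * f) * ‖meanVec x Sm - μ‖ ^ 2 ≤ (Real.sqrt 2 + 1) ^ 2 * V := by
    refine le_of_mul_le_mul_left (a := (m : ℝ)) ?_ hmpos
    have := mul_le_mul_of_nonneg_left h7 hqpos.le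
    linarith
  have e : (Real.sqrt 2 + 1) ^ 2 * (((n : ℝ) - f) / ((n : ℝ) - 2 * f)) * (((n : ℝ) - f)⁻¹ * V)
      = ((Real.sqrt 2 + 1) ^ 2 * V) / ((n : ℝ) - 2 * f) := by
    field_simp
  rw [e, le_div_iff₀ hqpos]
  linarith
end

section
/- Let d ≥ 1 and let n, f, m be integers with f ≥ 0, n > 2f, and 1 ≤ m ≤ n−f. For all vectors x_1,…,x_n ∈ ℝ^d, every neighbor selection N with associated score s, every m-MultiKrum selection S*_m, and every set S ⊆ {1,…,n} with |S| = n−f, one has ‖x̄_{S*_m} − x̄_S‖² ≤ ((n−f)/(n−2f)) · κ(m) · Σ_S, where κ(m) = (√(n−2f)/√m + √2 + 1)² if m ≤ f, and κ(m) = (√(n−2f)/√m + √(2f)/√m + f/m)² if m > f. -/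
open Finset

lemma mk_split {n : ℕ} (A S : Finset (Fin n)) (g : Fin n → ℝ) :
    ∑ i ∈ A \ S, g i + ∑ i ∈ A ∩ S, g i = ∑ i ∈ A, g i := by
  rw [add_comm]
  exact Finset.sum_inter_add_sum_sdiff A S g

lemma mk_nn_sum_le {n : ℕ} (g : Fin n → ℝ) (A S : Finset (Fin n)) (hc : A.card = S.card)
    (h : ∀ i ∈ A, ∀ j ∉ A, g i ≤ g j) : ∑ i ∈ A, g i ≤ ∑ i ∈ S, g i := by
  have e1 := mk_split A S g
  have e2 := mk_split S A g
  rw [Finset.inter_comm S A] at e2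
  have hcard : (A \ S).card = (S \ A).card := by
    have h1 := Finset.card_sdiff_add_card_inter A S
    have h2 := Finset.card_sdiff_add_card_inter S A
    rw [Finset.inter_comm S A] at h2
    omega
  have key : ∑ i ∈ A \ S, g i ≤ ∑ i ∈ S \ A, g i := by
    rcases (A \ S).eq_empty_or_nonempty with he | hne
    · have : S \ A = ∅ := by
        rw [← Finset.card_eq_zero, ← hcard, he, Finset.card_empty]
      rw [he, this]
    · obtain ⟨i0, hi0, hmax⟩ := Finset.exists_max_image (A \ S) g hne
      have h1 := Finset.sum_le_card_nsmul (A \ S) g (g i0) hmax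
      have h2 := Finset.card_nsmul_le_sum (S \ A) g (g i0) (fun j hj =>
        h i0 (Finset.mem_sdiff.1 hi0).1 j (Finset.mem_sdiff.1 hj).2)
      rw [hcard] at h1
      exact h1.trans h2
  linarith

lemma mk_sum_norm_le {n : ℕ} {E : Type*} [NormedAddCommGroup E] (v : Fin n → E)
    (A : Finset (Fin n)) (W : ℝ) (hW : ∑ i ∈ A, ‖v i‖ ^ 2 ≤ W) :
    ∑ i ∈ A, ‖v i‖ ≤ √(A.card : ℝ) * √W := by
  rw [← Real.sqrt_mul (by positivity)]
  apply Real.le_sqrt_of_sq_le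
  refine (sq_sum_le_card_mul_sum_sq (s := A) (f := fun i => ‖v i‖)).trans ?_
  gcongr

lemma mk_center {d n : ℕ} (x : Fin n → EuclideanSpace ℝ (Fin d)) (A : Finset (Fin n))
    (hA : A.Nonempty) : ∑ i ∈ A, (x i - meanVec x A) = 0 := by
  have : (A.card : ℝ) ≠ 0 := by exact_mod_cast hA.card_ne_zero
  rw [Finset.sum_sub_distrib, Finset.sum_const, meanVec, ← Nat.cast_smul_eq_nsmul ℝ,
    smul_smul, mul_inv_cancel₀ this, one_smul, sub_self]

lemma mk_huygens {d n : ℕ} (x : Fin n → EuclideanSpace ℝ (Fin d)) (A : Finset (Fin n))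
    (hA : A.Nonempty) (y : EuclideanSpace ℝ (Fin d)) :
    ∑ i ∈ A, ‖y - x i‖ ^ 2 =
      A.card * ‖y - meanVec x A‖ ^ 2 + ∑ i ∈ A, ‖x i - meanVec x A‖ ^ 2 := by
  have h : ∀ i ∈ A, ‖y - x i‖ ^ 2 = ‖y - meanVec x A‖ ^ 2
      - 2 * inner ℝ (y - meanVec x A) (x i - meanVec x A) + ‖x i - meanVec x A‖ ^ 2 := by
    intro i _
    rw [← norm_sub_sq_real]
    congr 2
    abel
  rw [Finset.sum_congr rfl h, Finset.sum_add_distrib, Finset.sum_sub_distrib,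
    ← Finset.mul_sum, ← inner_sum, mk_center x A hA]
  simp

set_option maxHeartbeats 1000000 in
/-- main bound -/
lemma mk_main {d : ℕ} (n f m : ℕ)
    (hn : 2 * f < n) (hm1 : 1 ≤ m) (hm2 : m ≤ n - f)
    (x : Fin n → EuclideanSpace ℝ (Fin d))
    (N : EuclideanSpace ℝ (Fin d) → Finset (Fin n)) (hN : IsNbhdSel f x N)
    (Sm : Finset (Fin n)) (hSm : IsMultiKrumSel m x (score f x N) Sm)
    (S : Finset (Fin n)) (hS : S.card = n - f) :
    ‖meanVec x Sm - meanVec x S‖ ≤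
      √(((n : ℝ) - f) / ((n : ℝ) - 2 * f) * varVec x S) *
        (√((n : ℝ) - 2 * f) / √m + √(2 * ((Sm \ S).card : ℝ)) / √m + ((Sm \ S).card : ℝ) / m) := by
  obtain ⟨hmc, hsel⟩ := hSm
  have hSne : S.Nonempty := Finset.card_pos.1 (by omega)
  set c := meanVec x S with hc
  set W := ∑ i ∈ S, ‖x i - c‖ ^ 2 with hW
  have hW0 : 0 ≤ W := Finset.sum_nonneg (fun _ _ => by positivity)
  have hfn : f ≤ n := by omega
  set h : ℝ := (n : ℝ) - f with hh
  have hhc : ((n - f : ℕ) : ℝ) = h := by push_cast [hfn]; rfl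
  have hScard : (S.card : ℝ) = h := by rw [hS, hhc]
  have hhpos : 0 < h := by rw [← hScard]; exact_mod_cast hSne.card_pos
  set q : ℝ := (n : ℝ) - 2 * f with hq
  have hqpos : 0 < q := by
    have : ((2 * f : ℕ) : ℝ) < n := by exact_mod_cast hn
    push_cast at this; linarith
  have hVW : h / q * varVec x S = W / q := by
    rw [varVec, ← hc, ← hW, hScard]; field_simp
  rw [hVW]
  have hmpos : (0 : ℝ) < m := by exact_mod_cast hm1
  have hmh : (m : ℝ) ≤ h := by rw [← hhc]; exact_mod_cast hm2
  set B := Sm \ S with hB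
  set A := Sm ∩ S with hA
  set b : ℝ := (B.card : ℝ) with hb
  have hb0 : 0 ≤ b := by positivity
  have hab : (A.card : ℝ) = m - b := by
    have := Finset.card_sdiff_add_card_inter Sm S
    rw [hmc] at this
    have h2 : (B.card : ℝ) + A.card = m := by exact_mod_cast this
    linarith
  have hbm : b ≤ m := by
    have : (0 : ℝ) ≤ A.card := by positivity
    linarith
  have hD : ((S \ Sm).card : ℝ) = h - m + b := by
    have := Finset.card_sdiff_add_card_inter S Sm
    rw [Finset.inter_comm] at this
    have h2 : ((S \ Sm).card : ℝ) + A.card = S.card := by exact_mod_cast this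
    rw [hScard] at h2
    linarith
  -- bound for A
  have hAb : ∑ i ∈ A, ‖x i - c‖ ≤ √(m : ℝ) * √W := by
    refine (mk_sum_norm_le (fun i => x i - c) A W ?_).trans ?_
    · exact Finset.sum_le_sum_of_subset_of_nonneg Finset.inter_subset_right
        (fun _ _ _ => by positivity)
    · have : (A.card : ℝ) ≤ m := by linarith
      exact mul_le_mul_of_nonneg_right (Real.sqrt_le_sqrt this) (Real.sqrt_nonneg _)
  -- bound for B
  have hBb : ∀ i ∈ B, b * ‖x i - c‖ ≤ (√(2 * b) * √m * √W + b * √W) / √q := by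
    intro i hi
    have hbpos : 0 < b := by
      rw [hb]; exact_mod_cast Finset.card_pos.2 ⟨i, hi⟩
    obtain ⟨hiSm, hiS⟩ := Finset.mem_sdiff.1 hi
    set H := ∑ k ∈ N (x i), ‖x i - x k‖ ^ 2 with hH
    have hH0 : 0 ≤ H := Finset.sum_nonneg (fun _ _ => by positivity)
    have hj : ∀ j ∈ S \ Sm, H ≤ h * ‖x j - c‖ ^ 2 + W := by
      intro j hj
      obtain ⟨hjS, hjm⟩ := Finset.mem_sdiff.1 hj
      have h1 := hsel i hiSm j hjm
      unfold score at h1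
      rw [← hh] at h1
      have h2 := le_of_mul_le_mul_left h1 (inv_pos.2 hhpos)
      have h3 := mk_nn_sum_le (fun k => ‖x j - x k‖ ^ 2) (N (x j)) S (by rw [(hN _).1, hS])
        (fun k hk l hl => by
          have := (hN (x j)).2 k hk l hl
          gcongr)
      rw [mk_huygens x S hSne (x j), ← hc, ← hW, hScard] at h3
      exact h2.trans h3
    have hsum := Finset.sum_le_sum hj
    rw [Finset.sum_const, Finset.sum_add_distrib, Finset.sum_const, nsmul_eq_mul, nsmul_eq_mul,
      hD, ← Finset.mul_sum] at hsum
    have hsub : ∑ j ∈ S \ Sm, ‖x j - c‖ ^ 2 ≤ W :=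
      Finset.sum_le_sum_of_subset_of_nonneg Finset.sdiff_subset (fun _ _ _ => by positivity)
    have hDpos : 0 < h - m + b := by linarith
    have hDH : (h - m + b) * H ≤ (h + (h - m + b)) * W := by
      nlinarith [mul_le_mul_of_nonneg_left hsub hhpos.le]
    have hbH : b * H ≤ 2 * m * W := by
      have e : b * (h + (h - m + b)) ≤ 2 * m * (h - m + b) := by
        nlinarith [mul_nonneg (sub_nonneg.2 hmh) (sub_nonneg.2 hbm),
          mul_nonneg hDpos.le (sub_nonneg.2 hbm)]
      have e1 := mul_le_mul_of_nonneg_left hDH hb0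
      have e2 := mul_le_mul_of_nonneg_right e hW0
      refine le_of_mul_le_mul_left ?_ hDpos
      linarith
    have hsH : b * √H ≤ √(2 * b) * √m * √W := by
      rw [← Real.sqrt_mul (by positivity), ← Real.sqrt_mul (by positivity)]
      apply Real.le_sqrt_of_sq_le
      rw [mul_pow, Real.sq_sqrt hH0]
      nlinarith [mul_le_mul_of_nonneg_left hbH hb0]
    -- local averaging
    set P := N (x i) ∩ S with hP
    have hPq : q ≤ (P.card : ℝ) := by
      have h1 := Finset.card_union_add_card_inter (N (x i)) S
      have h2 := Finset.card_le_univ (N (x i) ∪ S)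
      rw [Fintype.card_fin] at h2
      rw [(hN _).1, hS] at h1
      rw [← hP] at h1
      have : n ≤ P.card + 2 * f := by omega
      have h3 : (n : ℝ) ≤ P.card + 2 * f := by exact_mod_cast this
      linarith
    have hPpos : (0 : ℝ) < P.card := by linarith
    have hp1 : ∑ k ∈ P, ‖x i - x k‖ ≤ √(P.card : ℝ) * √H :=
      mk_sum_norm_le (fun k => x i - x k) P H
        (Finset.sum_le_sum_of_subset_of_nonneg Finset.inter_subset_left
          (fun _ _ _ => by positivity))
    have hp2 : ∑ k ∈ P, ‖x k - c‖ ≤ √(P.card : ℝ) * √W :=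
      mk_sum_norm_le (fun k => x k - c) P W
        (Finset.sum_le_sum_of_subset_of_nonneg Finset.inter_subset_right
          (fun _ _ _ => by positivity))
    have hp3 : (P.card : ℝ) * ‖x i - c‖ ≤ ∑ k ∈ P, ‖x i - x k‖ + ∑ k ∈ P, ‖x k - c‖ := by
      rw [← Finset.sum_add_distrib, ← nsmul_eq_mul, ← Finset.sum_const]
      exact Finset.sum_le_sum (fun k _ => norm_sub_le_norm_sub_add_norm_sub _ _ _)
    have hsP : 0 < √(P.card : ℝ) := Real.sqrt_pos.2 hPpos
    have hp4 : √(P.card : ℝ) * ‖x i - c‖ ≤ √H + √W := by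
      refine le_of_mul_le_mul_left ?_ hsP
      rw [← mul_assoc, Real.mul_self_sqrt hPpos.le]
      linarith
    have hp5 : √q * ‖x i - c‖ ≤ √H + √W :=
      le_trans (by gcongr) hp4
    rw [le_div_iff₀ (Real.sqrt_pos.2 hqpos)]
    have := mul_le_mul_of_nonneg_left hp5 hb0
    linarith
  have hBs : ∑ i ∈ B, ‖x i - c‖ ≤ (√(2 * b) * √m * √W + b * √W) / √q := by
    rcases B.eq_empty_or_nonempty with he | hne
    · rw [he, Finset.sum_empty]; positivity
    · have hbpos : 0 < b := by rw [hb]; exact_mod_cast hne.card_pos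
      have h1 := Finset.sum_le_sum hBb
      rw [← Finset.mul_sum, Finset.sum_const, nsmul_eq_mul] at h1
      exact le_of_mul_le_mul_left h1 hbpos
  have hmean : meanVec x Sm - c = (m : ℝ)⁻¹ • ∑ i ∈ Sm, (x i - c) := by
    rw [Finset.sum_sub_distrib, Finset.sum_const, smul_sub, hmc, ← Nat.cast_smul_eq_nsmul ℝ,
      smul_smul, inv_mul_cancel₀ hmpos.ne', one_smul, meanVec, hmc]
  have hnorm : ‖meanVec x Sm - c‖ ≤
      (m : ℝ)⁻¹ * (√m * √W + (√(2 * b) * √m * √W + b * √W) / √q) := by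
    rw [hmean, norm_smul, Real.norm_of_nonneg (by positivity)]
    gcongr
    refine (norm_sum_le _ _).trans ?_
    rw [← mk_split Sm S]
    linarith
  refine hnorm.trans (le_of_eq ?_)
  rw [Real.sqrt_div hW0]
  have hsq : √q ≠ 0 := (Real.sqrt_pos.2 hqpos).ne'
  have hsm : √(m : ℝ) ≠ 0 := (Real.sqrt_pos.2 hmpos).ne'
  have hmm : (m : ℝ) = √(m : ℝ) * √(m : ℝ) := (Real.mul_self_sqrt hmpos.le).symm
  generalize √(m : ℝ) = r at *
  rw [hmm]
  field_simp
  ring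

/-- Decreasing upper bound on the robustness coefficient of m-MultiKrum. -/
theorem multikrum_decreasing_upper_bound {d : ℕ} (hd : 1 ≤ d) (n f m : ℕ)
    (hn : 2 * f < n) (hm1 : 1 ≤ m) (hm2 : m ≤ n - f)
    (x : Fin n → EuclideanSpace ℝ (Fin d))
    (N : EuclideanSpace ℝ (Fin d) → Finset (Fin n)) (hN : IsNbhdSel f x N)
    (Sm : Finset (Fin n)) (hSm : IsMultiKrumSel m x (score f x N) Sm)
    (S : Finset (Fin n)) (hS : S.card = n - f) :
    ‖meanVec x Sm - meanVec x S‖ ^ 2 ≤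
      (((n : ℝ) - f) / ((n : ℝ) - 2 * f)) *
        (if m ≤ f then
          (Real.sqrt ((n : ℝ) - 2 * f) / Real.sqrt m + Real.sqrt 2 + 1) ^ 2
        else
          (Real.sqrt ((n : ℝ) - 2 * f) / Real.sqrt m
            + Real.sqrt (2 * f) / Real.sqrt m + (f : ℝ) / m) ^ 2) *
        varVec x S := by
  have key := mk_main n f m hn hm1 hm2 x N hN Sm hSm S hS
  have hmpos : (0 : ℝ) < m := by exact_mod_cast hm1
  have hbm : ((Sm \ S).card : ℝ) ≤ m := by
    have := Finset.card_le_card (Finset.sdiff_subset (s := Sm) (t := S))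
    rw [hSm.1] at this
    exact_mod_cast this
  have hbf : ((Sm \ S).card : ℝ) ≤ f := by
    have h1 : (Sm \ S).card ≤ Sᶜ.card := Finset.card_le_card (fun i hi => by
      simpa using (Finset.mem_sdiff.1 hi).2)
    rw [Finset.card_compl, Fintype.card_fin, hS] at h1
    have : (Sm \ S).card ≤ f := by omega
    exact_mod_cast this
  have hV : 0 ≤ ((n : ℝ) - f) / ((n : ℝ) - 2 * f) * varVec x S := by
    have h1 : ((2 * f : ℕ) : ℝ) < n := by exact_mod_cast hn
    push_cast at h1
    have h0 : (0 : ℝ) ≤ f := by positivity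
    have : 0 ≤ varVec x S := by unfold varVec; positivity
    exact mul_nonneg (div_nonneg (by linarith) (by linarith)) this
  have fin : ∀ K : ℝ, √((n : ℝ) - 2 * f) / √m + √(2 * ((Sm \ S).card : ℝ)) / √m
      + ((Sm \ S).card : ℝ) / m ≤ K →
      ‖meanVec x Sm - meanVec x S‖ ^ 2 ≤
        (((n : ℝ) - f) / ((n : ℝ) - 2 * f)) * K ^ 2 * varVec x S := by
    intro K hK
    have h1 := key.trans (mul_le_mul_of_nonneg_left hK (Real.sqrt_nonneg _))
    have h2 := pow_le_pow_left₀ (norm_nonneg _) h1 2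
    rw [mul_pow, Real.sq_sqrt hV] at h2
    linarith
  split_ifs with hmf
  · apply fin
    gcongr
    · rw [div_le_iff₀ (Real.sqrt_pos.2 hmpos), ← Real.sqrt_mul (by norm_num)]
      gcongr
    · rw [div_le_one hmpos]; exact hbm
  · apply fin
    gcongr
end

section
/- Let d ≥ 1 and let n, f, m be integers with f ≥ 1, n > 3f, and 1 ≤ m ≤ n−f. Set a = min(m, n−2f) and R(n,f,m) = ((n−f)²/(f(n−2f))) · ( (a·f/(n−f) + (m−a)) / m )². For every δ > 0 there exist vectors x_1,…,x_n ∈ ℝ^d and a set S ⊆ {1,…,n} with |S| = n−f and Σ_S > 0 such that for every neighbor selection N with associated score s and every m-MultiKrum selection S*_m, one has ‖x̄_{S*_m} − x̄_S‖² ≥ (R(n,f,m) − δ) · Σ_S. Consequently the robustness coefficient κ*_m of m-MultiKrum satisfies κ*_m ≥ R(n,f,m). -/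
open Finset

lemma mk_nbhd_unique {d n : ℕ} {f : ℕ} {x : Fin n → EuclideanSpace ℝ (Fin d)}
    {N : EuclideanSpace ℝ (Fin d) → Finset (Fin n)} (hN : IsNbhdSel f x N)
    (y : EuclideanSpace ℝ (Fin d)) (T : Finset (Fin n)) (hT : T.card = n - f)
    (h : ∀ i ∈ T, ∀ j ∉ T, ‖y - x i‖ < ‖y - x j‖) : N y = T := by
  obtain ⟨hc, hle⟩ := hN y
  by_contra hne
  have h1 : ¬ T ⊆ N y := fun hs => hne (Finset.eq_of_subset_of_card_le hs (by omega)).symm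
  have h2 : ¬ N y ⊆ T := fun hs => hne (Finset.eq_of_subset_of_card_le hs (by omega))
  obtain ⟨i, hi, hi'⟩ := Finset.not_subset.1 h1
  obtain ⟨j, hj, hj'⟩ := Finset.not_subset.1 h2
  exact absurd (hle j hj i hi') (not_le.2 (h i hi j hj'))

lemma mk_sel_chain {d n m : ℕ} {x : Fin n → EuclideanSpace ℝ (Fin d)}
    {s : EuclideanSpace ℝ (Fin d) → ℝ} {Sm : Finset (Fin n)} (hS : IsMultiKrumSel m x s Sm)
    (T : Finset (Fin n)) (h : ∀ i ∈ T, ∀ j ∉ T, s (x i) < s (x j)) : Sm ⊆ T ∨ T ⊆ Sm := by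
  by_contra hne
  rw [not_or] at hne
  obtain ⟨i, hi, hi'⟩ := Finset.not_subset.1 hne.1
  obtain ⟨j, hj, hj'⟩ := Finset.not_subset.1 hne.2
  exact absurd (hS.2 i hi j hj') (not_le.2 (h j hj i hi'))

lemma mk_mean {d n : ℕ} (e : EuclideanSpace ℝ (Fin d)) (c : Fin n → ℝ) (A : Finset (Fin n)) :
    meanVec (fun i => c i • e) A = ((A.card : ℝ)⁻¹ * ∑ i ∈ A, c i) • e := by
  simp only [meanVec]
  rw [← Finset.sum_smul, smul_smul]

lemma mk_norm {d : ℕ} {e : EuclideanSpace ℝ (Fin d)} (he : ‖e‖ = 1) (a b : ℝ) :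
    ‖a • e - b • e‖ = |a - b| := by
  rw [← sub_smul, norm_smul, he, mul_one, Real.norm_eq_abs]

/-- Lower bound R(n,f,m) on the robustness coefficient of m-MultiKrum. -/
theorem multikrum_m_lower_bound {d : ℕ} (hd : 1 ≤ d) (n f m : ℕ)
    (hf : 1 ≤ f) (hn : 3 * f < n) (hm1 : 1 ≤ m) (hm2 : m ≤ n - f)
    (δ : ℝ) (hδ : 0 < δ) :
    ∃ (x : Fin n → EuclideanSpace ℝ (Fin d)) (S : Finset (Fin n)),
      S.card = n - f ∧ 0 < varVec x S ∧
      ∀ N, IsNbhdSel f x N →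
        ∀ Sm, IsMultiKrumSel m x (score f x N) Sm →
          ‖meanVec x Sm - meanVec x S‖ ^ 2 ≥
            ((((n : ℝ) - f) ^ 2 / ((f : ℝ) * ((n : ℝ) - 2 * f))) *
              ((min (m : ℝ) ((n : ℝ) - 2 * f) * (f : ℝ) / ((n : ℝ) - f)
                + ((m : ℝ) - min (m : ℝ) ((n : ℝ) - 2 * f))) / (m : ℝ)) ^ 2
              - δ) * varVec x S := by
  obtain ⟨e, he⟩ : ∃ e : EuclideanSpace ℝ (Fin d), ‖e‖ = 1 :=
    ⟨EuclideanSpace.single ⟨0, hd⟩ 1, by simp⟩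
  -- three clusters: `Z` at `0`, `S \ Z` at `1`, `Sᶜ` at `-b`
  obtain ⟨Z, S, hZS, hZc, hSc⟩ : ∃ Z S : Finset (Fin n), Z ⊆ S ∧ Z.card = n - 2 * f ∧
      S.card = n - f := by
    obtain ⟨S, -, hS⟩ := Finset.exists_subset_card_eq
      (s := (Finset.univ : Finset (Fin n))) (n := n - f) (by simp)
    obtain ⟨Z, hZ, hZc⟩ := Finset.exists_subset_card_eq (s := S) (n := n - 2 * f) (by omega)
    exact ⟨Z, S, hZ, hZc, hS⟩
  have hBc : Sᶜ.card = f := by rw [Finset.card_compl, Fintype.card_fin]; omega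
  have hOc : (S \ Z).card = f := by rw [Finset.card_sdiff_of_subset hZS]; omega
  have hdisj : Disjoint Z Sᶜ :=
    Finset.disjoint_left.2 fun i hi hi' => (Finset.mem_compl.1 hi') (hZS hi)
  have hTc : (Z ∪ Sᶜ).card = n - f := by rw [Finset.card_union_of_disjoint hdisj]; omega
  have hfR : (1 : ℝ) ≤ f := by exact_mod_cast hf
  have hnR : 3 * (f : ℝ) < n := by exact_mod_cast hn
  have hmR : (1 : ℝ) ≤ m := by exact_mod_cast hm1
  have hZR : (Z.card : ℝ) = n - 2 * f := by
    rw [hZc, Nat.cast_sub (by omega)]; push_cast; ring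
  have hSR : (S.card : ℝ) = n - f := by
    rw [hSc, Nat.cast_sub (by omega)]
  have hBR : (Sᶜ.card : ℝ) = f := by rw [hBc]
  have hOR : ((S \ Z).card : ℝ) = f := by rw [hOc]
  have hnf : (0 : ℝ) < n - f := by linarith
  have hn2f : (0 : ℝ) < n - 2 * f := by linarith
  obtain ⟨b, hb⟩ : ∃ b : ℝ, b = (n - 2 * f) / (n - f) := ⟨_, rfl⟩
  have hb0 : 0 < b := by rw [hb]; positivity
  have hb1 : b < 1 := by rw [hb, div_lt_one hnf]; linarith
  obtain ⟨c, hc⟩ : ∃ c : Fin n → ℝ, c = fun i => if i ∈ Z then 0 else if i ∈ S then 1 else -b :=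
    ⟨_, rfl⟩
  have cZ : ∀ i ∈ Z, c i = 0 := fun i hi => by simp [hc, hi]
  have cO : ∀ i ∈ S \ Z, c i = 1 := fun i hi => by
    rw [Finset.mem_sdiff] at hi; simp [hc, hi.1, hi.2]
  have cB : ∀ i ∈ Sᶜ, c i = -b := fun i hi => by
    rw [Finset.mem_compl] at hi
    have : i ∉ Z := fun h => hi (hZS h)
    simp [hc, hi, this]
  have sumT : ∀ g : ℝ → ℝ, ∑ i ∈ Z ∪ Sᶜ, g (c i) = (n - 2 * f) * g 0 + f * g (-b) := by
    intro g
    rw [Finset.sum_union hdisj, Finset.sum_congr rfl (fun i hi => by rw [cZ i hi]),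
      Finset.sum_congr (s₁ := Sᶜ) rfl (fun i hi => by rw [cB i hi])]
    simp only [Finset.sum_const, nsmul_eq_mul, hZR, hBR]
  have sumS : ∀ g : ℝ → ℝ, ∑ i ∈ S, g (c i) = f * g 1 + (n - 2 * f) * g 0 := by
    intro g
    rw [← Finset.sum_sdiff hZS, Finset.sum_congr (s₁ := Z) rfl (fun i hi => by rw [cZ i hi]),
      Finset.sum_congr (s₁ := S \ Z) rfl (fun i hi => by rw [cO i hi])]
    simp only [Finset.sum_const, nsmul_eq_mul, hZR, hOR]
  have memT : ∀ i, i ∈ Z ∪ Sᶜ → c i = 0 ∨ c i = -b := fun i hi =>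
    (Finset.mem_union.1 hi).imp (cZ i) (cB i)
  have nmemT : ∀ i, i ∉ Z ∪ Sᶜ → i ∈ S \ Z := fun i hi => by
    simp only [Finset.mem_union, Finset.mem_compl, not_or, not_not] at hi
    exact Finset.mem_sdiff.2 ⟨hi.2, hi.1⟩
  have memS : ∀ i, i ∈ S → c i = 0 ∨ c i = 1 := fun i hi => by
    by_cases h : i ∈ Z
    · exact Or.inl (cZ i h)
    · exact Or.inr (cO i (Finset.mem_sdiff.2 ⟨hi, h⟩))
  have hmeanS : meanVec (fun i => c i • e) S = ((f : ℝ) / (n - f)) • e := by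
    rw [mk_mean, sumS (fun t => t), hSR]; congr 1; field_simp; ring
  have hvar : varVec (fun i => c i • e) S = f * (n - 2 * f) / (n - f) ^ 2 := by
    simp only [varVec]
    rw [hmeanS]
    simp only [mk_norm he, sq_abs]
    rw [sumS (fun t => (t - (f : ℝ) / (n - f)) ^ 2), hSR]
    field_simp
    ring
  refine ⟨fun i => c i • e, S, hSc, ?_, ?_⟩
  · rw [hvar]; positivity
  intro N hN Sm hSm
  have sc0 : score f (fun i => c i • e) N ((0 : ℝ) • e) = ((n : ℝ) - f)⁻¹ * (f * b ^ 2) := by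
    have : N ((0 : ℝ) • e) = Z ∪ Sᶜ := by
      refine mk_nbhd_unique hN _ _ hTc ?_
      intro i hi j hj
      simp only [mk_norm he]
      rw [cO j (nmemT j hj)]
      rcases memT i hi with h | h <;> rw [h] <;> simp [abs_of_pos hb0, hb1]
    simp only [score, this, mk_norm he, sq_abs]
    rw [sumT (fun t => (0 - t) ^ 2)]; ring
  have scB : score f (fun i => c i • e) N ((-b : ℝ) • e) =
      ((n : ℝ) - f)⁻¹ * ((n - 2 * f) * b ^ 2) := by
    have : N ((-b : ℝ) • e) = Z ∪ Sᶜ := by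
      refine mk_nbhd_unique hN _ _ hTc ?_
      intro i hi j hj
      simp only [mk_norm he]
      rw [cO j (nmemT j hj), abs_of_neg (by linarith : -b - 1 < 0)]
      rcases memT i hi with h | h <;> rw [h]
      · rw [abs_of_neg (by linarith)]; linarith
      · simp; linarith
    simp only [score, this, mk_norm he, sq_abs]
    rw [sumT (fun t => (-b - t) ^ 2)]; ring
  have sc1 : score f (fun i => c i • e) N ((1 : ℝ) • e) =
      ((n : ℝ) - f)⁻¹ * (n - 2 * f) := by
    have : N ((1 : ℝ) • e) = S := by
      refine mk_nbhd_unique hN _ _ hSc ?_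
      intro i hi j hj
      simp only [mk_norm he]
      rw [cB j (Finset.mem_compl.2 hj), abs_of_pos (by linarith : 0 < 1 - -b)]
      rcases memS i hi with h | h <;> rw [h]
      · simp; linarith
      · simp; linarith
    simp only [score, this, mk_norm he, sq_abs]
    rw [sumS (fun t => (1 - t) ^ 2)]; ring
  have hinv : 0 < ((n : ℝ) - f)⁻¹ := inv_pos.2 hnf
  have hb2 : 0 < b ^ 2 := by positivity
  have hb21 : b ^ 2 < 1 := by nlinarith
  have h0B : ((n : ℝ) - f)⁻¹ * (f * b ^ 2) < ((n : ℝ) - f)⁻¹ * ((n - 2 * f) * b ^ 2) :=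
    mul_lt_mul_of_pos_left (mul_lt_mul_of_pos_right (by linarith) hb2) hinv
  have hB1 : ((n : ℝ) - f)⁻¹ * ((n - 2 * f) * b ^ 2) < ((n : ℝ) - f)⁻¹ * (n - 2 * f) :=
    mul_lt_mul_of_pos_left (by nlinarith) hinv
  have chZ : Sm ⊆ Z ∨ Z ⊆ Sm := by
    refine mk_sel_chain hSm Z ?_
    intro i hi j hj
    beta_reduce
    rw [cZ i hi, sc0]
    by_cases h : j ∈ S
    · rw [cO j (Finset.mem_sdiff.2 ⟨h, hj⟩), sc1]; linarith
    · rw [cB j (Finset.mem_compl.2 h), scB]; exact h0B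
  have chT : Sm ⊆ Z ∪ Sᶜ := by
    have : Sm ⊆ Z ∪ Sᶜ ∨ Z ∪ Sᶜ ⊆ Sm := by
      refine mk_sel_chain hSm _ ?_
      intro i hi j hj
      beta_reduce
      rw [cO j (nmemT j hj), sc1]
      rcases memT i hi with h | h <;> rw [h]
      · rw [sc0]; linarith
      · rw [scB]; exact hB1
    rcases this with h | h
    · exact h
    · rw [Finset.eq_of_subset_of_card_le h (by rw [hTc, hSm.1]; exact hm2)]
  have hsum : ∑ i ∈ Sm, c i = -((m : ℝ) - min (m : ℝ) ((n : ℝ) - 2 * f)) * b := by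
    rcases chZ with h | h
    · rw [Finset.sum_eq_zero (fun i hi => cZ i (h hi))]
      have hle : (m : ℝ) ≤ n - 2 * f := by
        rw [← hZR, ← hSm.1]; exact_mod_cast Finset.card_le_card h
      rw [min_eq_left hle]; ring
    · have hle : (n : ℝ) - 2 * f ≤ m := by
        rw [← hZR, ← hSm.1]; exact_mod_cast Finset.card_le_card h
      rw [min_eq_right hle, ← Finset.sum_sdiff h, Finset.sum_eq_zero (s := Z) cZ,
        Finset.sum_congr (s₂ := Sm \ Z) (g := fun _ => -b) rfl]
      · rw [Finset.sum_const, nsmul_eq_mul, Finset.card_sdiff_of_subset h,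
          Nat.cast_sub (Finset.card_le_card h), hZR, hSm.1]; ring
      · intro i hi
        rw [Finset.mem_sdiff] at hi
        exact cB i ((Finset.mem_union.1 (chT hi.1)).resolve_left hi.2)
  rw [hmeanS, hvar, mk_mean, hsum, hSm.1, mk_norm he, sq_abs, hb]
  have hV : 0 ≤ δ * ((f : ℝ) * (n - 2 * f) / (n - f) ^ 2) := by positivity
  have hf0 : (f : ℝ) ≠ 0 := by positivity
  have hm0 : (m : ℝ) ≠ 0 := by positivity
  have hnf0 := hnf.ne'
  have hn2f0 := hn2f.ne'
  generalize min (m : ℝ) ((n : ℝ) - 2 * f) = a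
  rw [ge_iff_le, sub_mul]
  refine (sub_le_self _ hV).trans (le_of_eq ?_)
  have hK : ∀ X : ℝ, ((n : ℝ) - f) ^ 2 / ((f : ℝ) * ((n : ℝ) - 2 * f)) * X *
      ((f : ℝ) * ((n : ℝ) - 2 * f) / ((n : ℝ) - f) ^ 2) = X := by
    intro X
    generalize (n : ℝ) - 2 * f = p at *
    generalize (n : ℝ) - f = q at *
    field_simp
  rw [hK, ← neg_sq]
  congr 1
  field_simp
  ring
end
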